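/- arXiv:2206.01026 — 2 statements merged into one kernel-verified Lean document; each statement's English description precedes it below -/
import Mathlib

section
/- Let 2 < p < 3. For every n ≥ 1 and all real scalars a_1, …, a_n, not all zero, the sum S = a_1 ξ_1 + … + a_n ξ_n of independent random vectors uniform on the unit sphere S^3 in ℝ^4 satisfies E|S|^{-p} ≤ 2^{p/2} · (Γ(3-p) / (Γ(2 - p/2) Γ(3 - p/2))) · (a_1² + … + a_n²)^{-p/2}, with equality when n = 2 and a_1 = a_2. -/
open MeasureTheory Real Set
open scoped ENNReal

/-- `μ` is the uniform probability measure on the unit sphere `S^{d-1}` in `ℝ^d`: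
it is supported on the unit sphere and invariant under every orthogonal map. -/
def IsUniformOnSphere {d : ℕ} (μ : Measure (EuclideanSpace ℝ (Fin d))) : Prop :=
  μ (Metric.sphere (0 : EuclideanSpace ℝ (Fin d)) 1)ᶜ = 0 ∧
  ∀ Q : EuclideanSpace ℝ (Fin d) ≃ₗᵢ[ℝ] EuclideanSpace ℝ (Fin d), μ.map ⇑Q = μ

open scoped Topology
open ProbabilityTheory

namespace IsUniformOnSphere

variable {d : ℕ} {μ : Measure (EuclideanSpace ℝ (Fin d))}

lemma ae_norm_eq_one (hμ : IsUniformOnSphere μ) : ∀ᵐ x ∂μ, ‖x‖ = 1 := by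
  have h : ∀ᵐ x ∂μ, x ∈ Metric.sphere (0 : EuclideanSpace ℝ (Fin d)) 1 := hμ.1
  filter_upwards [h] with x hx
  simpa using hx

lemma integral_comp_isometry (hμ : IsUniformOnSphere μ)
    (Q : EuclideanSpace ℝ (Fin d) ≃ₗᵢ[ℝ] EuclideanSpace ℝ (Fin d))
    (f : EuclideanSpace ℝ (Fin d) → ℝ) : ∫ x, f (Q x) ∂μ = ∫ x, f x ∂μ := by
  conv_rhs => rw [← hμ.2 Q]
  exact (Q.toHomeomorph.measurableEmbedding.integral_map f).symm

/-- The law of `⟪x, y⟫` depends only on `‖y‖`. -/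
lemma map_inner_eq (hμ : IsUniformOnSphere μ) {y z : EuclideanSpace ℝ (Fin d)} (h : ‖y‖ = ‖z‖) :
    μ.map (fun x => inner ℝ x y) = μ.map (fun x => inner ℝ x z) := by
  set Q := (Submodule.reflection (ℝ ∙ (y - z))ᗮ)
  have hQ : Q y = z := Submodule.reflection_sub h
  conv_rhs => rw [← hμ.2 Q]
  rw [Measure.map_map (by fun_prop) (by fun_prop)]
  congr 1
  funext x
  simp only [Function.comp_apply]
  rw [← hQ, Q.inner_map_map]

lemma map_inner_eq_coord [NeZero d] (hμ : IsUniformOnSphere μ) (y : EuclideanSpace ℝ (Fin d)) :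
    μ.map (fun x => inner ℝ x y) = (μ.map (fun x => x 0)).map (fun t => ‖y‖ * t) := by
  rw [hμ.map_inner_eq (y := y) (z := EuclideanSpace.single 0 ‖y‖) (by simp),
    Measure.map_map (by fun_prop) (by fun_prop)]
  congr 1
  funext x
  simp [EuclideanSpace.inner_single_right]

end IsUniformOnSphere

/-- The reflection of `ℝ⁴` acting on the coordinates `0` and `j` by the matrix
`[[c, s], [s, -c]]`. -/
noncomputable def planeReflection (j : Fin 4) (hj : j ≠ 0) (c s : ℝ) (h : c ^ 2 + s ^ 2 = 1) :
    EuclideanSpace ℝ (Fin 4) ≃ₗᵢ[ℝ] EuclideanSpace ℝ (Fin 4) :=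
  LinearIsometryEquiv.mk
    (LinearEquiv.ofInvolutive
      { toFun := fun x => WithLp.toLp 2 fun i =>
          if i = 0 then c * x 0 + s * x j else if i = j then s * x 0 - c * x j else x i
        map_add' := by
          intro x y
          ext i
          simp only [PiLp.add_apply]
          split_ifs <;> ring
        map_smul' := by
          intro r x
          ext i
          simp only [PiLp.smul_apply, smul_eq_mul, RingHom.id_apply]
          split_ifs <;> ring }
      (by
        intro x
        ext i
        simp only [LinearMap.coe_mk, AddHom.coe_mk, hj, if_true, if_false]
        split_ifs with h0 h1
        · subst h0; linear_combination (x 0) * h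
        · subst h1; linear_combination (x i) * h
        · rfl))
    (by
      intro x
      rw [EuclideanSpace.norm_eq, EuclideanSpace.norm_eq]
      congr 1
      simp only [LinearEquiv.coe_ofInvolutive, LinearMap.coe_mk, AddHom.coe_mk,
        Fin.sum_univ_four, Real.norm_eq_abs, sq_abs]
      fin_cases j
      · exact absurd rfl hj
      · simp; linear_combination (x 0 ^ 2 + x 1 ^ 2) * h
      · simp; linear_combination (x 0 ^ 2 + x 2 ^ 2) * h
      · simp; linear_combination (x 0 ^ 2 + x 3 ^ 2) * h)

lemma planeReflection_zero (j : Fin 4) (hj : j ≠ 0) (c s : ℝ) (h : c ^ 2 + s ^ 2 = 1)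
    (x : EuclideanSpace ℝ (Fin 4)) :
    planeReflection j hj c s h x 0 = c * x 0 + s * x j := by
  simp [planeReflection, LinearEquiv.coe_ofInvolutive]

lemma planeReflection_self (j : Fin 4) (hj : j ≠ 0) (c s : ℝ) (h : c ^ 2 + s ^ 2 = 1)
    (x : EuclideanSpace ℝ (Fin 4)) :
    planeReflection j hj c s h x j = s * x 0 - c * x j := by
  simp [planeReflection, LinearEquiv.coe_ofInvolutive, hj]

/-- A probability measure on `[-1, 1]` satisfying the integration by parts identity of the law of a
coordinate of a uniform random point of `S³`, that is, of the semicircle law. -/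
structure SemicircleIdentity (τ : Measure ℝ) : Prop where
  ae_mem : ∀ᵐ x ∂τ, x ∈ Icc (-1 : ℝ) 1
  integral_eq : ∀ h h' : ℝ → ℝ, (∀ x ∈ Icc (-1 : ℝ) 1, HasDerivAt h (h' x) x) →
    ContinuousOn h' (Icc (-1) 1) → 3 * ∫ x, x * h x ∂τ = ∫ x, (1 - x ^ 2) * h' x ∂τ

lemma IsUniformOnSphere.integrable {d : ℕ} {μ : Measure (EuclideanSpace ℝ (Fin d))}
    [IsFiniteMeasure μ] (hμ : IsUniformOnSphere μ) {f : EuclideanSpace ℝ (Fin d) → ℝ}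
    (hf : ContinuousOn f (Metric.sphere 0 1)) : Integrable f μ := by
  have h := hf.integrableOn_compact (μ := μ) (isCompact_sphere _ _)
  rwa [IntegrableOn, Measure.restrict_eq_self_of_ae_mem (s := Metric.sphere 0 1) hμ.1] at h

lemma abs_rotation_le {d : ℕ} {x : EuclideanSpace ℝ (Fin d)} (hx : ‖x‖ = 1) {i j : Fin d}
    (hij : i ≠ j) {c s : ℝ} (h : c ^ 2 + s ^ 2 = 1) : c * x i + s * x j ∈ Icc (-1 : ℝ) 1 := by
  have h2 : x i ^ 2 + x j ^ 2 ≤ 1 := by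
    have h3 : ∑ k, x k ^ 2 = 1 := by
      rw [← EuclideanSpace.real_norm_sq_eq, hx, one_pow]
    rw [← h3, ← Finset.sum_pair (f := fun k => x k ^ 2) hij]
    exact Finset.sum_le_sum_of_subset_of_nonneg (Finset.subset_univ _) fun k _ _ => sq_nonneg _
  rw [mem_Icc, ← abs_le]
  apply abs_le_of_sq_le_sq _ zero_le_one
  nlinarith [sq_nonneg (c * x j - s * x i)]

open Topology in
lemma IsUniformOnSphere.integral_deriv_eq {μ : Measure (EuclideanSpace ℝ (Fin 4))}
    [IsProbabilityMeasure μ] (hμ : IsUniformOnSphere μ) {j : Fin 4} (hj : j ≠ 0) {h h' : ℝ → ℝ}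
    (hd : ∀ x ∈ Icc (-1 : ℝ) 1, HasDerivAt h (h' x) x) (hc : ContinuousOn h' (Icc (-1) 1)) :
    ∫ x, x 0 * h (x 0) ∂μ = ∫ x, x j ^ 2 * h' (x 0) ∂μ := by
  have hh : ContinuousOn h (Icc (-1) 1) := fun x hx => (hd x hx).continuousAt.continuousWithinAt
  obtain ⟨A, hA⟩ := isCompact_Icc.exists_bound_of_continuousOn hh
  obtain ⟨B, hB⟩ := isCompact_Icc.exists_bound_of_continuousOn hc
  have hcs : ∀ t : ℝ, cos t ^ 2 + sin t ^ 2 = 1 := fun t => by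
    rw [add_comm]; exact sin_sq_add_cos_sq t
  have hsc : ∀ t : ℝ, (-sin t) ^ 2 + cos t ^ 2 = 1 := fun t => by
    rw [neg_sq]; exact sin_sq_add_cos_sq t
  have hu : ∀ t : ℝ, MapsTo (fun x : EuclideanSpace ℝ (Fin 4) => cos t * x 0 + sin t * x j)
      (Metric.sphere 0 1) (Icc (-1) 1) := fun t x hx =>
    abs_rotation_le (by simpa using hx) hj.symm (hcs t)
  have hcu : ∀ t : ℝ, ContinuousOn
      (fun x : EuclideanSpace ℝ (Fin 4) => cos t * x 0 + sin t * x j) (Metric.sphere 0 1) :=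
    fun t => by fun_prop
  set F : ℝ → EuclideanSpace ℝ (Fin 4) → ℝ := fun t x =>
    h (cos t * x 0 + sin t * x j) * (sin t * x 0 - cos t * x j) with hF
  set F' : ℝ → EuclideanSpace ℝ (Fin 4) → ℝ := fun t x =>
    h' (cos t * x 0 + sin t * x j) * (-sin t * x 0 + cos t * x j) * (sin t * x 0 - cos t * x j)
      + h (cos t * x 0 + sin t * x j) * (cos t * x 0 + sin t * x j) with hF'
  have hFint : ∀ t, Integrable (F t) μ := fun t =>
    hμ.integrable ((hh.comp (hcu t) (hu t)).mul (by fun_prop))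
  have hF'int : ∀ t, Integrable (F' t) μ := fun t =>
    hμ.integrable ((((hc.comp (hcu t) (hu t)).mul (by fun_prop)).mul (by fun_prop)).add
      ((hh.comp (hcu t) (hu t)).mul (by fun_prop)))
  have hconst : ∀ t, ∫ x, F t x ∂μ = ∫ x, h (x 0) * x j ∂μ := fun t => by
    rw [← hμ.integral_comp_isometry (planeReflection j hj (cos t) (sin t) (hcs t))
      (fun x => h (x 0) * x j)]
    simp only [planeReflection_zero, planeReflection_self, hF]
  have key := hasDerivAt_integral_of_dominated_loc_of_deriv_le (μ := μ) (F := F) (F' := F')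
    (x₀ := 0) (s := univ) (bound := fun _ => B + A) Filter.univ_mem
    (Filter.Eventually.of_forall fun t => (hFint t).aestronglyMeasurable) (hFint 0)
    (hF'int 0).aestronglyMeasurable ?_ (integrable_const _) ?_
  · have h0 : HasDerivAt (fun t => ∫ x, F t x ∂μ) 0 0 := by
      simp only [hconst]
      exact hasDerivAt_const _ _
    have h1 := key.2.unique h0
    have h2 : ∀ x : EuclideanSpace ℝ (Fin 4), F' 0 x = x 0 * h (x 0) - x j ^ 2 * h' (x 0) := by
      intro x; simp [hF']; ring
    simp only [h2] at h1
    have hm : MapsTo (fun x : EuclideanSpace ℝ (Fin 4) => x 0) (Metric.sphere 0 1) (Icc (-1) 1) := by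
      simpa using hu 0
    rw [integral_sub] at h1
    · linarith
    · exact hμ.integrable (ContinuousOn.mul (by fun_prop) (hh.comp (by fun_prop) hm))
    · exact hμ.integrable (ContinuousOn.mul (by fun_prop) (hc.comp (by fun_prop) hm))
  · filter_upwards [hμ.ae_norm_eq_one] with x hx t _
    have a0 := abs_rotation_le hx hj.symm (hcs t)
    have a1 := abs_le.mpr (abs_rotation_le hx hj.symm (hsc t))
    have e1 : sin t * x 0 - cos t * x j = -(-sin t * x 0 + cos t * x j) := by ring
    simp only [hF']
    refine (norm_add_le _ _).trans (add_le_add ?_ ?_)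
    · rw [norm_mul, norm_mul, e1, norm_neg, Real.norm_eq_abs (-sin t * x 0 + cos t * x j)]
      have := hB _ a0
      calc _ ≤ ‖h' (cos t * x 0 + sin t * x j)‖ * 1 * 1 := by gcongr
        _ ≤ B := by linarith
    · rw [norm_mul, Real.norm_eq_abs (cos t * x 0 + sin t * x j)]
      have := hA _ a0
      have a2 := abs_le.mpr a0
      calc _ ≤ ‖h (cos t * x 0 + sin t * x j)‖ * 1 := by gcongr
        _ ≤ A := by linarith
  · filter_upwards [hμ.ae_norm_eq_one] with x hx t _
    have a0 := abs_rotation_le hx hj.symm (hcs t)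
    have d1 : HasDerivAt (fun t => cos t * x 0 + sin t * x j) (-sin t * x 0 + cos t * x j) t :=
      ((hasDerivAt_cos t).mul_const _).add ((hasDerivAt_sin t).mul_const _)
    have d2 : HasDerivAt (fun t => sin t * x 0 - cos t * x j) (cos t * x 0 + sin t * x j) t := by
      convert! ((hasDerivAt_sin t).mul_const (x 0)).sub ((hasDerivAt_cos t).mul_const (x j)) using 1
      ring
    exact ((hd _ a0).comp t d1).mul d2

lemma IsUniformOnSphere.mapsTo_coord : MapsTo (fun x : EuclideanSpace ℝ (Fin 4) => x 0)
    (Metric.sphere 0 1) (Icc (-1) 1) := fun x hx => by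
  simpa using abs_rotation_le (x := x) (by simpa using hx) (i := 0) (j := 1) (by simp)
    (c := 1) (s := 0) (by simp)

lemma IsUniformOnSphere.ae_coord_mem {μ : Measure (EuclideanSpace ℝ (Fin 4))}
    (hμ : IsUniformOnSphere μ) : ∀ᵐ t ∂(μ.map fun x => x 0), t ∈ Icc (-1 : ℝ) 1 := by
  refine (ae_map_iff (p := fun t => t ∈ Icc (-1 : ℝ) 1) (by fun_prop) measurableSet_Icc).2 ?_
  filter_upwards [hμ.ae_norm_eq_one] with x hx using mapsTo_coord (by simpa using hx)

theorem IsUniformOnSphere.semicircleIdentity {μ : Measure (EuclideanSpace ℝ (Fin 4))}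
    [IsProbabilityMeasure μ] (hμ : IsUniformOnSphere μ) :
    SemicircleIdentity (μ.map (fun x => x 0)) where
  ae_mem := hμ.ae_coord_mem
  integral_eq := by
    intro h h' hd hc
    have hh : ContinuousOn h (Icc (-1) 1) := fun x hx => (hd x hx).continuousAt.continuousWithinAt
    have hm := mapsTo_coord
    have hrestr : (μ.map (fun x => x 0)).restrict (Icc (-1) 1) = μ.map (fun x => x 0) :=
      Measure.restrict_eq_self_of_ae_mem hμ.ae_coord_mem
    rw [integral_map (by fun_prop), integral_map (by fun_prop)]
    · have hI : ∀ j : Fin 4, Integrable (fun x => x j ^ 2 * h' (x 0)) μ := fun j =>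
        hμ.integrable (ContinuousOn.mul (by fun_prop) (hc.comp (by fun_prop) hm))
      have h1 : ∫ x, (1 - x 0 ^ 2) * h' (x 0) ∂μ
          = ∫ x, (x 1 ^ 2 * h' (x 0) + x 2 ^ 2 * h' (x 0)) + x 3 ^ 2 * h' (x 0) ∂μ := by
        apply integral_congr_ae
        filter_upwards [hμ.ae_norm_eq_one] with x hx
        have h2 : x 0 ^ 2 + x 1 ^ 2 + x 2 ^ 2 + x 3 ^ 2 = 1 := by
          rw [← Fin.sum_univ_four (fun k => x k ^ 2), ← EuclideanSpace.real_norm_sq_eq, hx, one_pow]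
        linear_combination -h' (x 0) * h2
      have h12 : Integrable (fun x => x 1 ^ 2 * h' (x 0) + x 2 ^ 2 * h' (x 0)) μ :=
        (hI 1).add (hI 2)
      rw [h1, integral_add h12 (hI 3), integral_add (hI 1) (hI 2),
        ← hμ.integral_deriv_eq (j := 1) (by decide) hd hc,
        ← hμ.integral_deriv_eq (j := 2) (by decide) hd hc,
        ← hμ.integral_deriv_eq (j := 3) (by decide) hd hc]
      ring
    · rw [← hrestr]
      exact ContinuousOn.aestronglyMeasurable (by fun_prop) measurableSet_Icc
    · rw [← hrestr]
      exact ContinuousOn.aestronglyMeasurable (by fun_prop) measurableSet_Icc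

/-- A probability measure on `[-1, 1]` is determined by its moments. -/
lemma eq_of_forall_integral_pow_eq {μ ν : Measure ℝ} [IsProbabilityMeasure μ]
    [IsProbabilityMeasure ν] (hμ : ∀ᵐ x ∂μ, x ∈ Icc (-1 : ℝ) 1) (hν : ∀ᵐ x ∂ν, x ∈ Icc (-1 : ℝ) 1)
    (h : ∀ n : ℕ, ∫ x, x ^ n ∂μ = ∫ x, x ^ n ∂ν) : μ = ν := by
  refine Measure.ext_of_charFun (funext fun t => ?_)
  have key : ∀ (ρ : Measure ℝ) [IsProbabilityMeasure ρ], (∀ᵐ x ∂ρ, x ∈ Icc (-1 : ℝ) 1) →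
      HasSum (fun n : ℕ => ((t * Complex.I) ^ n / n.factorial : ℂ) * (∫ x, x ^ n ∂ρ : ℝ))
        (charFun ρ t) := by
    intro ρ _ hρ
    rw [charFun_apply_real]
    have e : ∀ n : ℕ, ((t * Complex.I) ^ n / n.factorial : ℂ) * (∫ x, x ^ n ∂ρ : ℝ)
        = ∫ x, ((t * Complex.I) ^ n / n.factorial : ℂ) * ((x ^ n : ℝ) : ℂ) ∂ρ := fun n => by
      rw [integral_const_mul, integral_complex_ofReal]
    simp_rw [e]
    refine hasSum_integral_of_dominated_convergence (fun n _ => |t| ^ n / n.factorial)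
      (fun n => by fun_prop) (fun n => ?_) (ae_of_all _ fun _ => summable_pow_div_factorial _)
      (integrable_const _) (ae_of_all _ fun x => ?_)
    · filter_upwards [hρ] with x hx
      have : |x| ^ n ≤ 1 := pow_le_one₀ (abs_nonneg _) (abs_le.mpr hx)
      simp only [norm_mul, norm_div, norm_pow, Complex.norm_real, Complex.norm_I, mul_one,
        Real.norm_eq_abs, Complex.norm_natCast]
      exact mul_le_of_le_one_right (by positivity) this
    · have := NormedSpace.expSeries_div_hasSum_exp (t * x * Complex.I : ℂ)
      rw [← Complex.exp_eq_exp_ℂ] at this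
      convert! this using 2 with n
      push_cast
      ring
  refine (key μ hμ).unique ?_
  simp_rw [h]
  exact key ν hν

namespace ProbabilityTheory

lemma ae_betaMeasure_mem (α β : ℝ) : ∀ᵐ x ∂betaMeasure α β, x ∈ Ioo (0 : ℝ) 1 := by
  rw [betaMeasure, ae_withDensity_iff (by unfold betaPDF; fun_prop)]
  refine ae_of_all _ fun x hx => ?_
  by_contra hn
  apply hx
  rw [betaPDF_eq, if_neg (fun h => hn ⟨h.1, h.2⟩), ENNReal.ofReal_zero]

lemma lintegral_rpow_betaMeasure {α β z : ℝ} (hα : 0 < α) (hβ : 0 < β) (hz : 0 < α + z) :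
    ∫⁻ x, ENNReal.ofReal (x ^ z) ∂betaMeasure α β
      = ENNReal.ofReal (beta (α + z) β / beta α β) := by
  have h1 := beta_pos hα hβ
  have h2 := beta_pos hz hβ
  rw [betaMeasure, lintegral_withDensity_eq_lintegral_mul _ (by unfold betaPDF; fun_prop)
    (by fun_prop)]
  have : ∀ x, (betaPDF α β * fun x => ENNReal.ofReal (x ^ z)) x
      = ENNReal.ofReal (beta (α + z) β / beta α β) * betaPDF (α + z) β x := fun x => by
    simp only [Pi.mul_apply, betaPDF]
    rw [← ENNReal.ofReal_mul (p := beta (α + z) β / beta α β) (by positivity)]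
    by_cases hx : 0 < x ∧ x < 1
    · have h3 : (0 : ℝ) ≤ (1 - x) ^ (β - 1) := rpow_nonneg (by linarith) _
      have h4 := rpow_pos_of_pos hx.1 (α - 1)
      rw [← ENNReal.ofReal_mul (p := betaPDFReal α β x) (by unfold betaPDFReal; rw [if_pos hx]; positivity)]
      simp only [betaPDFReal, if_pos hx]
      rw [show α + z - 1 = (α - 1) + z by ring, rpow_add hx.1]
      congr 1
      field_simp
    · simp [betaPDFReal, if_neg hx]
  simp_rw [this]
  rw [lintegral_const_mul _ (by unfold betaPDF; fun_prop), lintegral_betaPDF_eq_one hz hβ, mul_one]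

lemma integral_pow_betaMeasure {α β : ℝ} (hα : 0 < α) (hβ : 0 < β) (n : ℕ) :
    ∫ x, x ^ n ∂betaMeasure α β = beta (α + n) β / beta α β := by
  have := lintegral_rpow_betaMeasure hα hβ (z := n) (by positivity)
  rw [integral_eq_lintegral_of_nonneg_ae _ (by fun_prop)]
  · simp_rw [rpow_natCast] at this
    rw [this, ENNReal.toReal_ofReal]
    exact div_nonneg (beta_pos (by positivity) hβ).le (beta_pos hα hβ).le
  · filter_upwards [ae_betaMeasure_mem α β] with x hx using pow_nonneg hx.1.le n

end ProbabilityTheory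

namespace SemicircleIdentity

variable {τ : Measure ℝ} [IsProbabilityMeasure τ]

lemma integrable (hτ : SemicircleIdentity τ) {f : ℝ → ℝ} (hf : ContinuousOn f (Icc (-1) 1)) :
    Integrable f τ := by
  rw [← Measure.restrict_eq_self_of_ae_mem hτ.ae_mem]
  exact hf.integrableOn_compact isCompact_Icc

lemma affine_moment_succ (hτ : SemicircleIdentity τ) (k : ℕ) :
    (2 * k + 6) * ∫ x, ((1 + x) / 2) ^ (k + 1) ∂τ = (2 * k + 3) * ∫ x, ((1 + x) / 2) ^ k ∂τ := by
  have h := hτ.integral_eq (fun x => ((1 + x) / 2) ^ k) (fun x => k * ((1 + x) / 2) ^ (k - 1) / 2)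
    (fun x _ => by
      have := (((hasDerivAt_id x).const_add 1).div_const 2).pow k
      convert! this using 1
      simp; ring) (by fun_prop)
  have e1 : ∀ x : ℝ, x * ((1 + x) / 2) ^ k = 2 * ((1 + x) / 2) ^ (k + 1) - ((1 + x) / 2) ^ k :=
    fun x => by ring
  have e2 : ∀ x : ℝ, (1 - x ^ 2) * (k * ((1 + x) / 2) ^ (k - 1) / 2)
      = 2 * k * (((1 + x) / 2) ^ k - ((1 + x) / 2) ^ (k + 1)) := fun x => by
    rcases k with _ | k
    · simp
    · simp only [Nat.add_sub_cancel]; push_cast; ring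
  simp_rw [e1, e2] at h
  rw [integral_sub (hτ.integrable (by fun_prop)) (hτ.integrable (by fun_prop)), integral_const_mul,
    integral_const_mul, integral_sub (hτ.integrable (by fun_prop)) (hτ.integrable (by fun_prop))]
    at h
  linarith

/-- The image of the semicircle law under `x ↦ (1 + x) / 2` is a beta law. -/
lemma map_eq_betaMeasure (hτ : SemicircleIdentity τ) :
    τ.map (fun x => (1 + x) / 2) = betaMeasure (3 / 2) (3 / 2) := by
  have hB := isProbabilityMeasureBeta (α := 3 / 2) (β := 3 / 2) (by norm_num) (by norm_num)
  have hP : IsProbabilityMeasure (τ.map (fun x => (1 + x) / 2)) :=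
    Measure.isProbabilityMeasure_map (by fun_prop)
  refine eq_of_forall_integral_pow_eq ?_ ?_ fun n => ?_
  · refine (ae_map_iff (by fun_prop) measurableSet_Icc).2 ?_
    filter_upwards [hτ.ae_mem] with x hx
    constructor <;> linarith [hx.1, hx.2]
  · filter_upwards [ae_betaMeasure_mem _ _] with x hx
    constructor <;> linarith [hx.1, hx.2]
  · rw [integral_map (by fun_prop) (by fun_prop), integral_pow_betaMeasure (by norm_num)
      (by norm_num)]
    have hb := beta_pos (α := 3 / 2) (β := 3 / 2) (by norm_num) (by norm_num)
    induction n with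
    | zero => simp [hb.ne']
    | succ n ih =>
      have h := hτ.affine_moment_succ n
      rw [ih] at h
      have e : beta (3 / 2 + ((n + 1 : ℕ) : ℝ)) (3 / 2) * (2 * n + 6)
          = beta (3 / 2 + n) (3 / 2) * (2 * n + 3) := by
        have h1 : Gamma (3 / 2 + ((n + 1 : ℕ) : ℝ)) = (3 / 2 + n) * Gamma (3 / 2 + n) := by
          rw [← Gamma_add_one (by positivity)]; push_cast; ring_nf
        have h2 : Gamma (3 / 2 + ((n + 1 : ℕ) : ℝ) + 3 / 2)
            = (3 / 2 + n + 3 / 2) * Gamma (3 / 2 + n + 3 / 2) := by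
          rw [← Gamma_add_one (by positivity)]; push_cast; ring_nf
        unfold beta
        rw [h1, h2]
        field_simp
        ring
      have h6 : (0 : ℝ) < 2 * n + 6 := by positivity
      rw [← mul_right_inj' h6.ne', h, mul_div_assoc', mul_div_assoc', mul_comm _ (beta _ _), ← e,
        mul_comm (2 * (n : ℝ) + 6)]

/-- The negative moment of the sum of two independent uniform vectors. -/
lemma lintegral_rpow_two_add (hτ : SemicircleIdentity τ) {l : ℝ} (hl : l < 3 / 2) :
    ∫⁻ x, ENNReal.ofReal (2 + 2 * x) ^ (-l) ∂τ
      = ENNReal.ofReal (Gamma (3 - 2 * l) / (Gamma (2 - l) * Gamma (3 - l))) := by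
  have h1 : ∫⁻ x, ENNReal.ofReal (2 + 2 * x) ^ (-l) ∂τ
      = ∫⁻ w, ENNReal.ofReal (4 * w) ^ (-l) ∂(τ.map (fun x => (1 + x) / 2)) := by
    rw [lintegral_map (by fun_prop) (by fun_prop)]
    congr with x
    ring_nf
  have h2 : ∫⁻ w, ENNReal.ofReal (4 * w) ^ (-l) ∂(betaMeasure (3 / 2) (3 / 2))
      = ∫⁻ w, ENNReal.ofReal (4 ^ (-l)) * ENNReal.ofReal (w ^ (-l))
        ∂(betaMeasure (3 / 2) (3 / 2)) := by
    refine lintegral_congr_ae ?_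
    filter_upwards [ae_betaMeasure_mem _ _] with x hx
    rw [ENNReal.ofReal_rpow_of_pos (by linarith [hx.1]), mul_rpow (by norm_num) hx.1.le,
      ENNReal.ofReal_mul (by positivity)]
  rw [h1, hτ.map_eq_betaMeasure, h2, lintegral_const_mul _ (by fun_prop),
    lintegral_rpow_betaMeasure (by norm_num) (by norm_num) (by linarith),
    ← ENNReal.ofReal_mul (by positivity)]
  congr 1
  have d := Gamma_mul_Gamma_add_half (3 / 2 - l)
  have g : Gamma (3 / 2) = √π / 2 := by
    rw [show (3 / 2 : ℝ) = 1 / 2 + 1 by norm_num, Gamma_add_one (by norm_num), Gamma_one_half_eq]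
    ring
  have g3 : Gamma 3 = 2 := by
    rw [show (3 : ℝ) = (2 : ℕ) + 1 by norm_num, Gamma_nat_eq_factorial]; norm_num
  have p1 : 0 < Gamma (2 - l) := Gamma_pos_of_pos (by linarith)
  have p2 : 0 < Gamma (3 - l) := Gamma_pos_of_pos (by linarith)
  rw [show 3 / 2 - l + 1 / 2 = 2 - l by ring, show 2 * (3 / 2 - l) = 3 - 2 * l by ring,
    show 1 - (3 - 2 * l) = -2 + 2 * l by ring, rpow_add (by norm_num), rpow_mul (by norm_num)] at d
  have d4 : (4 : ℝ) ^ (-l) * ((2 : ℝ) ^ (2 : ℝ)) ^ l = 1 := by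
    rw [show (2 : ℝ) ^ (2 : ℝ) = 4 by norm_num, ← rpow_add (by norm_num)]; simp
  have d5 : (2 : ℝ) ^ (-2 : ℝ) = 1 / 4 := by
    rw [rpow_neg (by norm_num)]; norm_num
  rw [d5] at d
  unfold beta
  rw [show (3 / 2 : ℝ) + 3 / 2 = 3 by norm_num, show 3 / 2 + -l + 3 / 2 = 3 - l by ring, g, g3,
    ← sub_eq_add_neg]
  generalize Gamma (3 / 2 - l) = x at *
  generalize Gamma (2 - l) = y at *
  generalize Gamma (3 - 2 * l) = w at *
  generalize (4 : ℝ) ^ (-l) = u at *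
  generalize ((2 : ℝ) ^ (2 : ℝ)) ^ l = v at *
  field_simp
  linear_combination 4 * u * d + w * √π * d4

end SemicircleIdentity

/-- Differentiation under the integral sign over a measure carried by `[-1, 1]`. -/
lemma hasDerivAt_integral_of_continuousOn {τ : Measure ℝ} [IsFiniteMeasure τ]
    (hτ : ∀ᵐ x ∂τ, x ∈ Icc (-1 : ℝ) 1) {U : Set ℝ} (hU : IsOpen U) {f f' : ℝ → ℝ → ℝ}
    (hd : ∀ r ∈ U, ∀ x ∈ Icc (-1 : ℝ) 1, HasDerivAt (fun s => f s x) (f' r x) r)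
    (hf : ∀ r ∈ U, ContinuousOn (f r) (Icc (-1) 1))
    (hf' : ContinuousOn (fun z : ℝ × ℝ => f' z.1 z.2) (U ×ˢ Icc (-1) 1)) {r : ℝ} (hr : r ∈ U) :
    HasDerivAt (fun s => ∫ x, f s x ∂τ) (∫ x, f' r x ∂τ) r := by
  have hrestr := Measure.restrict_eq_self_of_ae_mem hτ
  have hm : ∀ {g : ℝ → ℝ}, ContinuousOn g (Icc (-1) 1) → AEStronglyMeasurable g τ := fun hg => by
    rw [← hrestr]; exact hg.aestronglyMeasurable measurableSet_Icc
  obtain ⟨ε, hε, hball⟩ := Metric.nhds_basis_closedBall.mem_iff.1 (hU.mem_nhds hr)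
  obtain ⟨C, hC⟩ := ((isCompact_closedBall r ε).prod isCompact_Icc).exists_bound_of_continuousOn
    (hf'.mono (prod_mono hball subset_rfl))
  refine (hasDerivAt_integral_of_dominated_loc_of_deriv_le (bound := fun _ => C)
    (Metric.closedBall_mem_nhds r hε) ?_ ?_ ?_ ?_ (integrable_const _) ?_).2
  · filter_upwards [hU.mem_nhds hr] with s hs using hm (hf s hs)
  · rw [← hrestr]; exact (hf r hr).integrableOn_compact isCompact_Icc
  · exact hm (hf'.comp (f := fun x => (r, x)) (by fun_prop) fun x hx => ⟨hr, hx⟩)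
  · filter_upwards [hτ] with x hx s hs using hC (s, x) ⟨hs, hx⟩
  · filter_upwards [hτ] with x hx s hs using hd s (hball hs) x hx

lemma integral_linear_combination_eq_zero {τ : Measure ℝ} {f₁ f₂ f₃ f₄ f₅ : ℝ → ℝ}
    (h₁ : Integrable f₁ τ) (h₂ : Integrable f₂ τ) (h₃ : Integrable f₃ τ) (h₄ : Integrable f₄ τ)
    (h₅ : Integrable f₅ τ) (c₁ c₂ c₃ c₄ c₅ : ℝ)
    (h : ∀ᵐ x ∂τ, c₁ * f₁ x + c₂ * f₂ x + c₃ * f₃ x + c₄ * f₄ x + c₅ * f₅ x = 0) :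
    c₁ * (∫ x, f₁ x ∂τ) + c₂ * (∫ x, f₂ x ∂τ) + c₃ * (∫ x, f₃ x ∂τ) + c₄ * (∫ x, f₄ x ∂τ)
      + c₅ * (∫ x, f₅ x ∂τ) = 0 := by
  have h₁ := h₁.const_mul c₁
  have h₂ := h₂.const_mul c₂
  have h₃ := h₃.const_mul c₃
  have h₄ := h₄.const_mul c₄
  have h₅ := h₅.const_mul c₅
  have h12 : Integrable (fun x => c₁ * f₁ x + c₂ * f₂ x) τ := h₁.add h₂
  have h123 : Integrable (fun x => c₁ * f₁ x + c₂ * f₂ x + c₃ * f₃ x) τ := h12.add h₃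
  have h1234 : Integrable (fun x => c₁ * f₁ x + c₂ * f₂ x + c₃ * f₃ x + c₄ * f₄ x) τ :=
    h123.add h₄
  simp only [← integral_const_mul]
  rw [← integral_add h₁ h₂, ← integral_add h12 h₃, ← integral_add h123 h₄, ← integral_add h1234 h₅]
  exact integral_eq_zero_of_ae h

lemma one_add_sq_add_pos {r x : ℝ} (hr : r ∈ Ioo (-1 : ℝ) 1) (hx : x ∈ Icc (-1 : ℝ) 1) :
    0 < 1 + r ^ 2 + 2 * r * x := by
  have : -|r| ≤ r * x := by
    have := abs_mul r x
    have h1 : |r| * |x| ≤ |r| := mul_le_of_le_one_right (abs_nonneg _) (abs_le.2 hx)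
    linarith [neg_abs_le (r * x)]
  nlinarith [abs_lt.2 hr, sq_abs r, mul_pos (sub_pos.2 (abs_lt.2 hr)) (sub_pos.2 (abs_lt.2 hr))]

lemma hasDerivAt_rpow_one_add_sq_add {r x : ℝ} (hr : r ∈ Ioo (-1 : ℝ) 1)
    (hx : x ∈ Icc (-1 : ℝ) 1) (z : ℝ) :
    HasDerivAt (fun s => (1 + s ^ 2 + 2 * s * x) ^ z)
      (2 * z * ((r + x) * (1 + r ^ 2 + 2 * r * x) ^ (z - 1))) r := by
  have h : HasDerivAt (fun s => 1 + s ^ 2 + 2 * s * x) (2 * (r + x)) r := by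
    convert! (((hasDerivAt_id r).pow 2).const_add 1).add
      (((hasDerivAt_id r).const_mul 2).mul_const x) using 1
    simp; ring
  convert! h.rpow_const (p := z) (Or.inl (one_add_sq_add_pos hr hx).ne') using 1
  ring

lemma lintegral_rpow_one_add_sq_add_le (τ : Measure ℝ) {l : ℝ} (hl : 0 ≤ l) {r : ℝ}
    (hr : 0 < r) :
    ∫⁻ x, ENNReal.ofReal (1 + r ^ 2 + 2 * r * x) ^ (-l) ∂τ
      ≤ ENNReal.ofReal (r ^ (-l)) * ∫⁻ x, ENNReal.ofReal (2 + 2 * x) ^ (-l) ∂τ := by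
  rw [← lintegral_const_mul _ (by fun_prop)]
  refine lintegral_mono fun x => ?_
  rw [← ENNReal.ofReal_rpow_of_pos hr, ← ENNReal.mul_rpow_of_ne_top (by simp) (by simp),
    ← ENNReal.ofReal_mul hr.le]
  rw [ENNReal.rpow_neg, ENNReal.rpow_neg, ENNReal.inv_le_inv]
  refine ENNReal.rpow_le_rpow (ENNReal.ofReal_le_ofReal ?_) hl
  nlinarith [sq_nonneg (1 - r)]

namespace SemicircleIdentity

variable {τ : Measure ℝ} [IsProbabilityMeasure τ]

lemma continuousOn_rpow_one_add_sq_add (z : ℝ) :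
    ContinuousOn (fun w : ℝ × ℝ => (1 + w.1 ^ 2 + 2 * w.1 * w.2) ^ z)
      (Ioo (-1) 1 ×ˢ Icc (-1) 1) :=
  ContinuousOn.rpow_const (by fun_prop) fun _ hw => Or.inl (one_add_sq_add_pos hw.1 hw.2).ne'

lemma continuousOn_rpow_one_add_sq_add_right (z : ℝ) {r : ℝ} (hr : r ∈ Ioo (-1 : ℝ) 1) :
    ContinuousOn (fun x => (1 + r ^ 2 + 2 * r * x) ^ z) (Icc (-1) 1) :=
  ContinuousOn.rpow_const (by fun_prop) fun _ hx => Or.inl (one_add_sq_add_pos hr hx).ne'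

/-- The radial derivative of a subharmonic radial mean is nonnegative. -/
lemma integral_add_mul_rpow_nonpos (hτ : SemicircleIdentity τ) {l : ℝ} (hl : 1 ≤ l) {r : ℝ}
    (hr : r ∈ Ioo (0 : ℝ) 1) :
    ∫ x, (r + x) * (1 + r ^ 2 + 2 * r * x) ^ (-l - 1) ∂τ ≤ 0 := by
  set K : ℝ → ℝ := fun r => ∫ x, (r + x) * (1 + r ^ 2 + 2 * r * x) ^ (-l - 1) ∂τ with hK
  have dK : ∀ r ∈ Ioo (-1 : ℝ) 1, HasDerivAt K (∫ x, ((1 + r ^ 2 + 2 * r * x) ^ (-l - 1)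
      - 2 * (l + 1) * (r + x) ^ 2 * (1 + r ^ 2 + 2 * r * x) ^ (-l - 2)) ∂τ) r := fun r hr => by
    refine hasDerivAt_integral_of_continuousOn hτ.ae_mem isOpen_Ioo
      (f := fun r x => (r + x) * (1 + r ^ 2 + 2 * r * x) ^ (-l - 1))
      (f' := fun r x => ((1 + r ^ 2 + 2 * r * x) ^ (-l - 1)
      - 2 * (l + 1) * (r + x) ^ 2 * (1 + r ^ 2 + 2 * r * x) ^ (-l - 2)))
      (fun r hr x hx => ?_) (fun r hr => ?_) ?_ hr
    · convert! ((hasDerivAt_id r).add_const x).mul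
        (hasDerivAt_rpow_one_add_sq_add hr hx (-l - 1)) using 1
      rw [show -l - 1 - 1 = -l - 2 by ring]
      simp only [id]
      ring
    · exact ContinuousOn.mul (by fun_prop) (continuousOn_rpow_one_add_sq_add_right _ hr)
    · exact (continuousOn_rpow_one_add_sq_add _).sub
        (ContinuousOn.mul (by fun_prop) (continuousOn_rpow_one_add_sq_add _))
  have dG : ∀ r ∈ Ioo (-1 : ℝ) 1, HasDerivAt (fun r => r ^ 3 * K r)
      (r ^ 3 * ((2 - 2 * l) * ∫ x, (1 + r ^ 2 + 2 * r * x) ^ (-l - 1) ∂τ)) r := fun r hr => by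
    have c1 := continuousOn_rpow_one_add_sq_add_right (-l - 1) hr
    have c2 := continuousOn_rpow_one_add_sq_add_right (-l - 2) hr
    have hid := hτ.integral_eq (fun x => (1 + r ^ 2 + 2 * r * x) ^ (-l - 1))
      (fun x => 2 * r * (-l - 1) * (1 + r ^ 2 + 2 * r * x) ^ (-l - 2)) (fun x hx => by
        have h : HasDerivAt (fun x => 1 + r ^ 2 + 2 * r * x) (2 * r) x := by
          simpa using ((hasDerivAt_id x).const_mul (2 * r)).const_add (1 + r ^ 2)
        convert! h.rpow_const (p := -l - 1) (Or.inl (one_add_sq_add_pos hr hx).ne') using 1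
        ring_nf) (by fun_prop)
    convert! (hasDerivAt_pow 3 r).mul (dK r hr) using 1
    simp only [hK, Nat.cast_ofNat, Nat.add_one_sub_one]
    have := integral_linear_combination_eq_zero
      (hτ.integrable c1)
      (hτ.integrable (f := fun x => (r + x) * (1 + r ^ 2 + 2 * r * x) ^ (-l - 1)) (by fun_prop))
      (hτ.integrable (f := fun x => ((1 + r ^ 2 + 2 * r * x) ^ (-l - 1)
        - 2 * (l + 1) * (r + x) ^ 2 * (1 + r ^ 2 + 2 * r * x) ^ (-l - 2))) (by fun_prop))
      (hτ.integrable (f := fun x => x * (1 + r ^ 2 + 2 * r * x) ^ (-l - 1)) (by fun_prop))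
      (hτ.integrable (f := fun x => (1 - x ^ 2) *
        (2 * r * (-l - 1) * (1 + r ^ 2 + 2 * r * x) ^ (-l - 2))) (by fun_prop))
      (r * (2 - 2 * l)) (-3) (-r) 3 (-1) (by
        filter_upwards [hτ.ae_mem] with x hx
        rw [show -l - 1 = -l - 2 + 1 by ring, rpow_add_one (one_add_sq_add_pos hr hx).ne']
        ring)
    linear_combination r ^ 2 * this - r ^ 2 * hid
  have hanti : AntitoneOn (fun r => r ^ 3 * K r) (Icc 0 r) := by
    have hsub : ∀ s ∈ Icc 0 r, s ∈ Ioo (-1 : ℝ) 1 := fun s hs =>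
      ⟨by linarith [hs.1], by linarith [hs.2, hr.2]⟩
    refine antitoneOn_of_hasDerivWithinAt_nonpos (convex_Icc _ _)
      (fun s hs => (dG s (hsub s hs)).continuousAt.continuousWithinAt)
      (fun s hs => (dG s (hsub s (interior_subset hs))).hasDerivWithinAt) fun s hs => ?_
    have hs := interior_subset hs
    refine mul_nonpos_of_nonneg_of_nonpos (pow_nonneg hs.1 3)
      (mul_nonpos_of_nonpos_of_nonneg (by linarith) (integral_nonneg_of_ae ?_))
    filter_upwards [hτ.ae_mem] with x hx
      using rpow_nonneg (one_add_sq_add_pos (hsub s hs) hx).le _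
  have := hanti (left_mem_Icc.2 hr.1.le) (right_mem_Icc.2 hr.1.le) hr.1.le
  simp only [zero_pow three_ne_zero, zero_mul] at this
  exact nonpos_of_mul_nonpos_right this (pow_pos hr.1 3)

lemma lintegral_rpow_mono (hτ : SemicircleIdentity τ) {l : ℝ} (hl : 1 ≤ l) {r s : ℝ} (hr : 0 ≤ r)
    (hrs : r ≤ s) (hs : s < 1) :
    ∫⁻ x, ENNReal.ofReal (1 + r ^ 2 + 2 * r * x) ^ (-l) ∂τ
      ≤ ∫⁻ x, ENNReal.ofReal (1 + s ^ 2 + 2 * s * x) ^ (-l) ∂τ := by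
  have hU : ∀ t ∈ Icc 0 s, t ∈ Ioo (-1 : ℝ) 1 := fun t ht =>
    ⟨by linarith [ht.1], by linarith [ht.2]⟩
  have e : ∀ t ∈ Icc 0 s, ∫⁻ x, ENNReal.ofReal (1 + t ^ 2 + 2 * t * x) ^ (-l) ∂τ
      = ENNReal.ofReal (∫ x, (1 + t ^ 2 + 2 * t * x) ^ (-l) ∂τ) := fun t ht => by
    rw [ofReal_integral_eq_lintegral_ofReal
      (hτ.integrable (continuousOn_rpow_one_add_sq_add_right _ (hU t ht)))]
    · refine lintegral_congr_ae ?_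
      filter_upwards [hτ.ae_mem] with x hx
        using ENNReal.ofReal_rpow_of_pos (one_add_sq_add_pos (hU t ht) hx)
    · filter_upwards [hτ.ae_mem] with x hx
        using rpow_nonneg (one_add_sq_add_pos (hU t ht) hx).le _
  have dH : ∀ t ∈ Ioo (-1 : ℝ) 1, HasDerivAt (fun r => ∫ x, (1 + r ^ 2 + 2 * r * x) ^ (-l) ∂τ)
      (∫ x, 2 * -l * ((t + x) * (1 + t ^ 2 + 2 * t * x) ^ (-l - 1)) ∂τ) t := fun t ht =>
    hasDerivAt_integral_of_continuousOn hτ.ae_mem isOpen_Ioo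
      (f := fun r x => (1 + r ^ 2 + 2 * r * x) ^ (-l))
      (f' := fun t x => 2 * -l * ((t + x) * (1 + t ^ 2 + 2 * t * x) ^ (-l - 1)))
      (fun r hr x hx => hasDerivAt_rpow_one_add_sq_add hr hx _)
      (fun r hr => continuousOn_rpow_one_add_sq_add_right _ hr)
      (continuousOn_const.mul (ContinuousOn.mul (by fun_prop)
        (continuousOn_rpow_one_add_sq_add _))) ht
  have hmono : MonotoneOn (fun r => ∫ x, (1 + r ^ 2 + 2 * r * x) ^ (-l) ∂τ) (Icc 0 s) := by
    refine monotoneOn_of_hasDerivWithinAt_nonneg (convex_Icc _ _)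
      (fun t ht => (dH t (hU t ht)).continuousAt.continuousWithinAt)
      (fun t ht => (dH t (hU t (interior_subset ht))).hasDerivWithinAt) fun t ht => ?_
    rw [interior_Icc] at ht
    rw [integral_const_mul]
    exact mul_nonneg_of_nonpos_of_nonpos (by linarith)
      (hτ.integral_add_mul_rpow_nonpos hl ⟨ht.1, ht.2.trans hs⟩)
  rw [e r ⟨hr, hrs⟩, e s ⟨hr.trans hrs, le_rfl⟩]
  exact ENNReal.ofReal_le_ofReal (hmono ⟨hr, hrs⟩ ⟨hr.trans hrs, le_rfl⟩ hrs)

lemma lintegral_rpow_le (hτ : SemicircleIdentity τ) {l : ℝ} (hl : 1 ≤ l) (hl' : l < 3 / 2) {r : ℝ}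
    (hr : 0 ≤ r) :
    ∫⁻ x, ENNReal.ofReal (1 + r ^ 2 + 2 * r * x) ^ (-l) ∂τ
      ≤ ENNReal.ofReal (Gamma (3 - 2 * l) / (Gamma (2 - l) * Gamma (3 - l))) := by
  have hle := fun {r : ℝ} hr => lintegral_rpow_one_add_sq_add_le τ (zero_le_one.trans hl) (r := r) hr
  rw [hτ.lintegral_rpow_two_add hl'] at hle
  rcases le_or_gt 1 r with h1 | h1
  · refine (hle (by linarith)).trans (mul_le_of_le_one_left' ?_)
    rw [ENNReal.ofReal_le_one]
    exact rpow_le_one_of_one_le_of_nonpos h1 (by linarith)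
  · refine ge_of_tendsto (x := 𝓝[<] (1 : ℝ))
      (f := fun s => ENNReal.ofReal (s ^ (-l)) *
        ENNReal.ofReal (Gamma (3 - 2 * l) / (Gamma (2 - l) * Gamma (3 - l)))) ?_ ?_
    · have : Filter.Tendsto (fun s : ℝ => s ^ (-l)) (𝓝[<] 1) (𝓝 (1 ^ (-l))) :=
        (continuousAt_rpow_const _ _ (Or.inl one_ne_zero)).tendsto.mono_left nhdsWithin_le_nhds
      have h2 := ENNReal.Tendsto.mul_const (ENNReal.tendsto_ofReal this)
        (b := ENNReal.ofReal (Gamma (3 - 2 * l) / (Gamma (2 - l) * Gamma (3 - l))))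
        (Or.inr ENNReal.ofReal_ne_top)
      simpa using h2
    · filter_upwards [Ioo_mem_nhdsLT h1] with s hs
      exact (hτ.lintegral_rpow_mono hl hr hs.1.le hs.2).trans (hle (hr.trans_lt hs.1))

end SemicircleIdentity

/-- The Taylor polynomials of `cos` and `sin` at `0` alternately bound them on `[0, ∞)`. -/
lemma neg_one_pow_mul_cos_sin_sub_taylor_nonneg (n : ℕ) :
    (∀ y : ℝ, 0 ≤ y → 0 ≤ (-1) ^ (n + 1) *
      (cos y - ∑ k ∈ Finset.range (n + 1), (-1) ^ k * y ^ (2 * k) / (2 * k).factorial)) ∧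
    (∀ y : ℝ, 0 ≤ y → 0 ≤ (-1) ^ (n + 1) *
      (sin y - ∑ k ∈ Finset.range (n + 1), (-1) ^ k * y ^ (2 * k + 1) / (2 * k + 1).factorial)) := by
  have mono : ∀ f f' : ℝ → ℝ, (∀ y, HasDerivAt f (f' y) y) → f 0 = 0 → (∀ y, 0 ≤ y → 0 ≤ f' y) →
      ∀ y, 0 ≤ y → 0 ≤ f y := fun f f' hd h0 hf' y hy => by
    have : MonotoneOn f (Ici 0) := monotoneOn_of_hasDerivWithinAt_nonneg (convex_Ici 0)
      (fun y _ => (hd y).continuousAt.continuousWithinAt) (fun y _ => (hd y).hasDerivWithinAt)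
      (fun y hy => hf' y (interior_subset hy))
    simpa [h0] using this self_mem_Ici hy hy
  have sin_of_cos : ∀ n : ℕ, (∀ y : ℝ, 0 ≤ y → 0 ≤ (-1) ^ (n + 1) *
      (cos y - ∑ k ∈ Finset.range (n + 1), (-1) ^ k * y ^ (2 * k) / (2 * k).factorial)) →
      (∀ y : ℝ, 0 ≤ y → 0 ≤ (-1) ^ (n + 1) * (sin y -
        ∑ k ∈ Finset.range (n + 1), (-1) ^ k * y ^ (2 * k + 1) / (2 * k + 1).factorial)) := by
    refine fun n h => mono _ _ (fun y => ?_) (by simp) h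
    refine (((hasDerivAt_sin y).sub (HasDerivAt.fun_sum fun k _ => ?_)).const_mul _)
    convert! ((hasDerivAt_pow (2 * k + 1) y).const_mul ((-1) ^ k)).div_const _ using 1
    rw [Nat.factorial_succ]
    push_cast
    field_simp
  induction n with
  | zero =>
    have : ∀ y : ℝ, 0 ≤ y → 0 ≤ (-1) ^ (0 + 1) * (cos y -
        ∑ k ∈ Finset.range (0 + 1), (-1) ^ k * y ^ (2 * k) / (2 * k).factorial) := fun y _ => by
      simpa using cos_le_one y
    exact ⟨this, sin_of_cos 0 this⟩
  | succ n ih =>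
    have : ∀ y : ℝ, 0 ≤ y → 0 ≤ (-1) ^ (n + 1 + 1) * (cos y -
        ∑ k ∈ Finset.range (n + 1 + 1), (-1) ^ k * y ^ (2 * k) / (2 * k).factorial) := by
      refine mono _ _ (fun y => ?_) (by simp [Finset.sum_range_succ']) ih.2
      have e : (fun y : ℝ => (-1) ^ (n + 1 + 1) * (cos y -
          ∑ k ∈ Finset.range (n + 1 + 1), (-1) ^ k * y ^ (2 * k) / (2 * k).factorial))
          = fun y : ℝ => (-1) ^ (n + 1) * (∑ k ∈ Finset.range (n + 1),
            -((-1) ^ k * y ^ (2 * k + 2) / (2 * k + 2).factorial) + 1 - cos y) := by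
        funext y
        rw [Finset.sum_range_succ', pow_succ _ (n + 1)]
        have : ∑ k ∈ Finset.range (n + 1),
            (-1) ^ (k + 1) * y ^ (2 * (k + 1)) / (2 * (k + 1)).factorial
            = ∑ k ∈ Finset.range (n + 1), -((-1) ^ k * y ^ (2 * k + 2) / (2 * k + 2).factorial) :=
          Finset.sum_congr rfl fun k _ => by rw [mul_add 2 k 1, mul_one]; ring
        rw [this]
        simp only [pow_zero, mul_zero, Nat.factorial_zero, Nat.cast_one, div_one, mul_one]
        ring
      rw [e]
      have : -(∑ k ∈ Finset.range (n + 1), (-1) ^ k * y ^ (2 * k + 1) / (2 * k + 1).factorial)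
          = ∑ k ∈ Finset.range (n + 1), -((-1) ^ k * y ^ (2 * k + 1) / (2 * k + 1).factorial) := by
        simp
      rw [sub_eq_add_neg, this, add_comm (sin y)]
      refine HasDerivAt.const_mul _ ?_
      have h := ((HasDerivAt.fun_sum fun k (_ : k ∈ Finset.range (n + 1)) =>
        ((((hasDerivAt_pow (2 * k + 2) y).const_mul ((-1) ^ k)).div_const
          ((2 * k + 2).factorial : ℝ))).fun_neg).add_const 1).sub (hasDerivAt_cos y)
      convert! h using 1
      rw [sub_neg_eq_add]
      congr 1
      refine Finset.sum_congr rfl fun k _ => ?_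
      rw [Nat.factorial_succ (2 * k + 1)]
      push_cast
      field_simp
      simp
      ring
    exact ⟨this, sin_of_cos _ this⟩

lemma cos_mem_Icc_taylor (y : ℝ) : cos y ∈ Icc
    (1 - y ^ 2 / 2 + y ^ 4 / 24 - y ^ 6 / 720)
    (1 - y ^ 2 / 2 + y ^ 4 / 24 - y ^ 6 / 720 + y ^ 8 / 40320) := by
  have key : ∀ z : ℝ, 0 ≤ z → cos z ∈ Icc (1 - z ^ 2 / 2 + z ^ 4 / 24 - z ^ 6 / 720)
      (1 - z ^ 2 / 2 + z ^ 4 / 24 - z ^ 6 / 720 + z ^ 8 / 40320) := fun z hz => by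
    have h1 := (neg_one_pow_mul_cos_sin_sub_taylor_nonneg 3).1 z hz
    have h2 := (neg_one_pow_mul_cos_sin_sub_taylor_nonneg 4).1 z hz
    simp [Finset.sum_range_succ, Nat.factorial] at h1 h2
    constructor <;> linarith
  rcases le_total 0 y with h | h
  · exact key y h
  · have := key (-y) (by linarith)
    rwa [cos_neg, Even.neg_pow (by decide), Even.neg_pow (by decide), Even.neg_pow (by decide),
      Even.neg_pow (by decide)] at this

lemma mul_sin_mem_Icc_taylor (y : ℝ) : y * sin y ∈ Icc
    (y ^ 2 - y ^ 4 / 6 + y ^ 6 / 120 - y ^ 8 / 5040)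
    (y ^ 2 - y ^ 4 / 6 + y ^ 6 / 120 - y ^ 8 / 5040 + y ^ 10 / 362880) := by
  have key : ∀ z : ℝ, 0 ≤ z → z * sin z ∈ Icc (z ^ 2 - z ^ 4 / 6 + z ^ 6 / 120 - z ^ 8 / 5040)
      (z ^ 2 - z ^ 4 / 6 + z ^ 6 / 120 - z ^ 8 / 5040 + z ^ 10 / 362880) := fun z hz => by
    have h1 := mul_nonneg hz ((neg_one_pow_mul_cos_sin_sub_taylor_nonneg 3).2 z hz)
    have h2 := mul_nonneg hz ((neg_one_pow_mul_cos_sin_sub_taylor_nonneg 4).2 z hz)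
    simp [Finset.sum_range_succ, Nat.factorial] at h1 h2
    constructor <;> linarith
  rcases le_total 0 y with h | h
  · exact key y h
  · have := key (-y) (by linarith)
    rwa [sin_neg, neg_mul_neg, Even.neg_pow (by decide), Even.neg_pow (by decide),
      Even.neg_pow (by decide), Even.neg_pow (by decide), Even.neg_pow (by decide)] at this

namespace SemicircleIdentity

variable {τ : Measure ℝ} [IsProbabilityMeasure τ]

lemma moment_add_two (hτ : SemicircleIdentity τ) (n : ℕ) :
    (n + 4) * ∫ x, x ^ (n + 2) ∂τ = (n + 1) * ∫ x, x ^ n ∂τ := by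
  have h := hτ.integral_eq (fun x => x ^ (n + 1)) (fun x => (n + 1 : ℕ) * x ^ n)
    (fun x _ => hasDerivAt_pow (n + 1) x) (by fun_prop)
  have e1 : ∀ x : ℝ, x * x ^ (n + 1) = x ^ (n + 2) := fun x => by ring
  have e2 : ∀ x : ℝ, (1 - x ^ 2) * ((n + 1 : ℕ) * x ^ n)
      = (n + 1 : ℕ) * (x ^ n - x ^ (n + 2)) := fun x => by ring
  simp_rw [e1, e2] at h
  rw [integral_const_mul, integral_sub (hτ.integrable (by fun_prop))
    (hτ.integrable (by fun_prop))] at h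
  push_cast at h
  linarith

lemma integral_even_polynomial (hτ : SemicircleIdentity τ) (c₀ c₁ c₂ c₃ c₄ c₅ : ℝ) :
    ∫ x, (c₀ + c₁ * x ^ 2 + c₂ * x ^ 4 + c₃ * x ^ 6 + c₄ * x ^ 8 + c₅ * x ^ 10) ∂τ
      = c₀ + c₁ / 4 + c₂ / 8 + c₃ * (5 / 64) + c₄ * (7 / 128) + c₅ * (21 / 512) := by
  have m0 := hτ.moment_add_two 0
  have m2 := hτ.moment_add_two 2
  have m4 := hτ.moment_add_two 4
  have m6 := hτ.moment_add_two 6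
  have m8 := hτ.moment_add_two 8
  norm_num at m0 m2 m4 m6 m8
  rw [integral_add (hτ.integrable (by fun_prop)) (hτ.integrable (by fun_prop)),
    integral_add (hτ.integrable (by fun_prop)) (hτ.integrable (by fun_prop)),
    integral_add (hτ.integrable (by fun_prop)) (hτ.integrable (by fun_prop)),
    integral_add (hτ.integrable (by fun_prop)) (hτ.integrable (by fun_prop)),
    integral_add (hτ.integrable (by fun_prop)) (hτ.integrable (by fun_prop))]
  simp only [integral_const_mul, integral_const, probReal_univ, smul_eq_mul, one_mul]
  linear_combination (c₁ / 4 + c₂ / 8 + c₃ * (5 / 64) + c₄ * (7 / 128) + c₅ * (21 / 512)) * m0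
    + (c₂ / 6 + c₃ * 5 / 48 + c₄ * 7 / 96 + c₅ * 7 / 128) * m2
    + (c₃ / 8 + c₄ * 7 / 80 + c₅ * 21/320) * m4 + (c₄ / 10 + c₅ * 9 / 120) * m6 + c₅ / 12 * m8

lemma integral_cos_mem_Icc (hτ : SemicircleIdentity τ) (t : ℝ) : ∫ x, cos (t * x) ∂τ ∈ Icc
    (1 - t ^ 2 / 8 + t ^ 4 / 192 - t ^ 6 / 9216)
    (1 - t ^ 2 / 8 + t ^ 4 / 192 - t ^ 6 / 9216 + t ^ 8 / 737280) := by
  have hcos := hτ.integrable (f := fun x => cos (t * x)) (by fun_prop)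
  constructor
  · have := hτ.integral_even_polynomial 1 (-t ^ 2 / 2) (t ^ 4 / 24) (-t ^ 6 / 720) 0 0
    calc _ = _ := by rw [this]; ring
      _ ≤ _ := integral_mono (hτ.integrable (by fun_prop)) hcos
        fun x => by linarith [(cos_mem_Icc_taylor (t * x)).1]
  · have := hτ.integral_even_polynomial 1 (-t ^ 2 / 2) (t ^ 4 / 24) (-t ^ 6 / 720)
      (t ^ 8 / 40320) 0
    refine le_of_le_of_eq ?_ (this.trans (by ring))
    refine integral_mono hcos (hτ.integrable (by fun_prop)) fun x => ?_
    have := (cos_mem_Icc_taylor (t * x)).2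
    beta_reduce
    linarith

lemma abs_integral_mul_sin_four_le (hτ : SemicircleIdentity τ) :
    |∫ x, x * sin (4 * x) ∂τ| ≤ 5 / 27 := by
  have hsin := hτ.integrable (f := fun x => x * sin (4 * x)) (by fun_prop)
  rw [abs_le]
  constructor
  · have := hτ.integral_even_polynomial 0 4 (-32 / 3) (128 / 15) (-1024 / 315) 0
    calc _ ≤ _ := by rw [this]; norm_num
      _ ≤ _ := integral_mono (hτ.integrable (by fun_prop)) hsin
        fun x => by linarith [(mul_sin_mem_Icc_taylor (4 * x)).1]
  · have := hτ.integral_even_polynomial 0 4 (-32 / 3) (128 / 15) (-1024 / 315) (2048 / 2835)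
    refine le_of_le_of_eq ?_ (this.trans (by norm_num))
    refine integral_mono hsin (hτ.integrable (by fun_prop)) fun x => ?_
    have := (mul_sin_mem_Icc_taylor (4 * x)).2
    beta_reduce
    linarith

/-- The energy of the Bessel-type equation `t (φ'' + φ) + 3 φ' = 0` is nonincreasing. -/
lemma abs_integral_cos_le_of_four_le (hτ : SemicircleIdentity τ) {t : ℝ} (ht : 4 ≤ t) :
    |∫ x, cos (t * x) ∂τ| ≤ 27 / 125 := by
  have dc : ∀ t, HasDerivAt (fun t => ∫ x, cos (t * x) ∂τ) (∫ x, -(x * sin (t * x)) ∂τ) t :=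
    fun t => hasDerivAt_integral_of_continuousOn hτ.ae_mem isOpen_univ
      (f := fun t x => cos (t * x)) (f' := fun t x => -(x * sin (t * x)))
      (fun r _ x _ => by
        convert! (hasDerivAt_mul_const x (x := r)).cos using 1; ring)
      (fun r _ => by fun_prop) (by fun_prop) (mem_univ t)
  have ds : ∀ t, HasDerivAt (fun t => ∫ x, x * sin (t * x) ∂τ) (∫ x, x ^ 2 * cos (t * x) ∂τ) t :=
    fun t => hasDerivAt_integral_of_continuousOn hτ.ae_mem isOpen_univ
      (f := fun t x => x * sin (t * x)) (f' := fun t x => x ^ 2 * cos (t * x))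
      (fun r _ x _ => by
        convert! ((hasDerivAt_mul_const x (x := r)).sin).const_mul x using 1; ring)
      (fun r _ => by fun_prop) (by fun_prop) (mem_univ t)
  have hid : ∀ t, 3 * ∫ x, x * sin (t * x) ∂τ
      = t * (∫ x, cos (t * x) ∂τ - ∫ x, x ^ 2 * cos (t * x) ∂τ) := fun t => by
    rw [hτ.integral_eq (fun x => sin (t * x)) (fun x => t * cos (t * x)) (fun x _ => by
      convert! ((hasDerivAt_id x).const_mul t).sin using 1; simp; ring) (by fun_prop),
      ← integral_sub (hτ.integrable (by fun_prop)) (hτ.integrable (by fun_prop)),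
      ← integral_const_mul]
    congr with x
    ring
  have hanti : AntitoneOn (fun t => (∫ x, cos (t * x) ∂τ) ^ 2 + (∫ x, x * sin (t * x) ∂τ) ^ 2)
      (Ici 4) := by
    refine antitoneOn_of_hasDerivWithinAt_nonpos (convex_Ici _)
      (fun t _ => (((dc t).pow 2).add ((ds t).pow 2)).continuousAt.continuousWithinAt)
      (fun t _ => (((dc t).pow 2).add ((ds t).pow 2)).hasDerivWithinAt) fun t ht => ?_
    have ht : (4 : ℝ) < t := by simpa using ht
    rw [integral_neg]
    have h := hid t
    generalize ∫ x, x ^ 2 * cos (t * x) ∂τ = w at *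
    generalize ∫ x, cos (t * x) ∂τ = c at *
    generalize ∫ x, x * sin (t * x) ∂τ = s at *
    have : c - w = 3 * s / t := by field_simp; linarith
    have h2 : 0 ≤ s * (3 * s / t) := by
      rw [show s * (3 * s / t) = 3 * s ^ 2 / t by ring]; positivity
    rw [← this] at h2
    norm_num
    nlinarith
  have h := hanti self_mem_Ici ht ht
  have h1 := hτ.integral_cos_mem_Icc 4
  have h2 := abs_le.1 hτ.abs_integral_mul_sin_four_le
  simp only at h
  rw [← sq_le_sq₀ (abs_nonneg _) (by norm_num), sq_abs]
  have h3 : (∫ x, cos (4 * x) ∂τ) ^ 2 ≤ (1 / 9) ^ 2 := by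
    apply sq_le_sq' <;> [skip; skip] <;> norm_num at h1 ⊢ <;> linarith [h1.1, h1.2]
  nlinarith [sq_nonneg (∫ x, x * sin (t * x) ∂τ)]

lemma abs_integral_cos_le_one (t : ℝ) : |∫ x, cos (t * x) ∂τ| ≤ 1 := by
  simpa using norm_integral_le_of_norm_le_const (μ := τ) (f := fun x => cos (t * x)) (C := 1)
    (ae_of_all _ fun x => abs_cos_le_one _)

lemma abs_integral_cos_le_cube (hτ : SemicircleIdentity τ) {u : ℝ} (hu : 0 ≤ u)
    (hu' : u ≤ 12 / 5) : |∫ x, cos (2 * √u * x) ∂τ| ≤ (1 - u / 6) ^ 3 := by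
  have h := hτ.integral_cos_mem_Icc (2 * √u)
  have e2 : (2 * √u) ^ 2 = 4 * u := by rw [mul_pow, sq_sqrt hu]; norm_num
  rw [show (2 * √u) ^ 8 = ((2 * √u) ^ 2) ^ 4 by ring, show (2 * √u) ^ 6 = ((2 * √u) ^ 2) ^ 3 by ring,
    show (2 * √u) ^ 4 = ((2 * √u) ^ 2) ^ 2 by ring, e2] at h
  have h3 : u ^ 3 * u ≤ u ^ 3 * (12 / 5) := by gcongr
  refine abs_le.2 ⟨?_, by nlinarith [h.2]⟩
  nlinarith [h.1, mul_nonneg (show 0 ≤ 4 - u by linarith)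
    (show 0 ≤ u ^ 2 / 144 - u / 18 + 5 / 18 by nlinarith [sq_nonneg (u - 4)])]

lemma abs_integral_cos_le_of_le (hτ : SemicircleIdentity τ) {u : ℝ} (hu : 12 / 5 ≤ u) :
    |∫ x, cos (2 * √u * x) ∂τ| ≤ 27 / 125 := by
  rcases le_or_gt 4 u with h4 | h4
  · refine hτ.abs_integral_cos_le_of_four_le ?_
    have : 2 ≤ √u := le_sqrt_of_sq_le (by linarith)
    linarith
  have h := hτ.integral_cos_mem_Icc (2 * √u)
  have e2 : (2 * √u) ^ 2 = 4 * u := by rw [mul_pow, sq_sqrt (by linarith)]; norm_num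
  rw [show (2 * √u) ^ 8 = ((2 * √u) ^ 2) ^ 4 by ring, show (2 * √u) ^ 6 = ((2 * √u) ^ 2) ^ 3 by ring,
    show (2 * √u) ^ 4 = ((2 * √u) ^ 2) ^ 2 by ring, e2] at h
  have h3 : u ^ 3 * u ≤ u ^ 3 * 4 := by gcongr
  refine abs_le.2 ⟨?_, by nlinarith [h.2]⟩
  nlinarith [h.1, mul_nonneg (show 0 ≤ 4 - u by linarith)
    (show 0 ≤ u ^ 2 / 144 - u / 18 + 5 / 18 by nlinarith [sq_nonneg (u - 4)])]

end SemicircleIdentity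

lemma integral_mul_one_sub_div_six_rpow {a : ℝ} (ha : 0 ≤ a) :
    ∫ u in (0 : ℝ)..(12 / 5), u * (1 - u / 6) ^ a
      = 36 * ((1 - (3 / 5) ^ (a + 1)) / (a + 1) - (1 - (3 / 5) ^ (a + 2)) / (a + 2)) := by
  have hz : ∀ u ∈ uIcc (0 : ℝ) (12 / 5), 0 < 1 - u / 6 := fun u hu => by
    rw [uIcc_of_le (by norm_num)] at hu
    linarith [hu.2]
  rw [intervalIntegral.integral_eq_sub_of_hasDerivAt
    (f := fun u => -36 * ((1 - u / 6) ^ (a + 1) / (a + 1) - (1 - u / 6) ^ (a + 2) / (a + 2)))]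
  · norm_num
    ring
  · intro u hu
    have h : HasDerivAt (fun u : ℝ => 1 - u / 6) (-(1 / 6)) u :=
      ((hasDerivAt_id u).div_const 6).const_sub 1
    have h1 := (h.rpow_const (p := a + 1) (Or.inl (hz u hu).ne')).div_const (a + 1)
    have h2 := (h.rpow_const (p := a + 2) (Or.inl (hz u hu).ne')).div_const (a + 2)
    convert! (h1.sub h2).const_mul (-36) using 1
    rw [show a + 2 - 1 = a + 1 by ring, add_sub_cancel_right, rpow_add_one (hz u hu).ne']
    field_simp
    ring
  · refine ContinuousOn.intervalIntegrable ?_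
    exact continuousOn_id.mul (ContinuousOn.rpow_const (by fun_prop)
      fun u hu => Or.inl (hz u hu).ne')

lemma rpow_mul_cubic_le_one {x : ℝ} (hx : 0 ≤ x) :
    (27 / 125 : ℝ) ^ x * (1 + 3 / 2 * x + 9 / 8 * x ^ 2 + 9 / 16 * x ^ 3) ≤ 1 := by
  have h1 : 1 + 3 / 2 * x + 9 / 8 * x ^ 2 + 9 / 16 * x ^ 3 ≤ exp (3 / 2 * x) := by
    have := Real.sum_le_exp_of_nonneg (x := 3 / 2 * x) (by positivity) 4
    simp [Finset.sum_range_succ, Nat.factorial] at this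
    linarith
  have h2 : (27 / 125 : ℝ) ≤ exp (-(3 / 2)) := by
    rw [← sq_le_sq₀ (by norm_num) (exp_pos _).le, ← exp_nat_mul]
    rw [show ((2 : ℕ) : ℝ) * -(3 / 2) = -((3 : ℕ) * 1) by norm_num, exp_neg, exp_nat_mul,
      le_inv_comm₀ (by norm_num) (by positivity)]
    calc exp 1 ^ 3 ≤ 2.7182818286 ^ 3 := by gcongr; exact exp_one_lt_d9.le
      _ ≤ _ := by norm_num
  calc _ ≤ exp (-(3 / 2)) ^ x * exp (3 / 2 * x) := by gcongr
    _ = 1 := by rw [← exp_mul, ← exp_add]; ring_nf; simp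

/-- The value of `∫ u (e^{-su/2} - ρ^{s-2} e^{-u}) du`, with `ρ = 27/125`, dominates that of the
truncated polynomial profile. -/
lemma polynomial_profile_le {s : ℝ} (hs : 2 ≤ s) :
    36 * ((1 - (3 / 5 : ℝ) ^ (3 * s + 1)) / (3 * s + 1) - (1 - (3 / 5) ^ (3 * s + 2)) / (3 * s + 2))
      - (27 / 125) ^ (s - 2) *
        (36 * ((1 - (3 / 5 : ℝ) ^ (6 + 1 : ℝ)) / (6 + 1) - (1 - (3 / 5) ^ (6 + 2 : ℝ)) / (6 + 2)))
      ≤ 4 / s ^ 2 - (27 / 125) ^ (s - 2) := by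
  obtain ⟨x, hx, rfl⟩ : ∃ x, 0 ≤ x ∧ s = 2 + x := ⟨s - 2, by linarith, by ring⟩
  have e : (3 / 5 : ℝ) ^ (3 * (2 + x)) = (27 / 125) ^ 2 * (27 / 125) ^ x := by
    rw [rpow_mul (by norm_num), rpow_add (by norm_num)]
    norm_num
  have e1 : (3 / 5 : ℝ) ^ (3 * (2 + x) + 1) = (27 / 125) ^ 2 * (27 / 125) ^ x * (3 / 5) := by
    rw [rpow_add_one (by norm_num), e]
  have e2 : (3 / 5 : ℝ) ^ (3 * (2 + x) + 2) = (27 / 125) ^ 2 * (27 / 125) ^ x * (3 / 5) ^ 2 := by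
    rw [rpow_add (by norm_num), e]
    norm_num
  have e3 : (3 / 5 : ℝ) ^ (6 + 1 : ℝ) = (3 / 5) ^ 7 := by
    rw [← rpow_natCast]; norm_num
  have e4 : (3 / 5 : ℝ) ^ (6 + 2 : ℝ) = (3 / 5) ^ 8 := by
    rw [← rpow_natCast]; norm_num
  rw [e1, e2, e3, e4, show 2 + x - 2 = x by ring]
  have hR := rpow_mul_cubic_le_one hx
  have hR0 : (0 : ℝ) < (27 / 125) ^ x := by positivity
  generalize (27 / 125 : ℝ) ^ x = R at *
  have p0 : 0 < (2 + x) ^ 2 * (3 * (2 + x) + 1) * (3 * (2 + x) + 2) := by positivity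
  rw [← sub_nonneg]
  have key : 0 ≤ (36 * (2 + x) + 8) + R * (2 + x) ^ 2 * (36 * (27 / 125) ^ 2 *
      (3 / 5 * (3 * (2 + x) + 2) - (3 / 5) ^ 2 * (3 * (2 + x) + 1))
      - (1 - 36 * ((1 - (3 / 5) ^ 7) / (6 + 1) - (1 - (3 / 5) ^ 8) / (6 + 2)))
        * (3 * (2 + x) + 1) * (3 * (2 + x) + 2)) := by
    have h1 : R * (1 + 3 / 2 * x + 9 / 8 * x ^ 2 + 9 / 16 * x ^ 3) * (36 * (2 + x) + 8)
        ≤ 1 * (36 * (2 + x) + 8) := by gcongr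
    have h2 : 0 ≤ R * ((1 + 3 / 2 * x + 9 / 8 * x ^ 2 + 9 / 16 * x ^ 3) * (36 * (2 + x) + 8)
        + (2 + x) ^ 2 * (36 * (27 / 125) ^ 2 *
      (3 / 5 * (3 * (2 + x) + 2) - (3 / 5) ^ 2 * (3 * (2 + x) + 1))
      - (1 - 36 * ((1 - (3 / 5) ^ 7) / (6 + 1) - (1 - (3 / 5) ^ 8) / (6 + 2)))
        * (3 * (2 + x) + 1) * (3 * (2 + x) + 2))) := by
      refine mul_nonneg hR0.le ?_
      ring_nf
      positivity
    linarith
  refine (div_nonneg key p0.le).trans_eq ?_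
  field_simp
  ring

/-- The test function `v ↦ v ^ s - ρ ^ (s - 2) v ^ 2`, with `ρ = 27 / 125`. -/
noncomputable def powExcess (s v : ℝ) : ℝ := v ^ s - (27 / 125) ^ (s - 2) * v ^ 2

lemma powExcess_eq {s v : ℝ} (hs : 2 ≤ s) (hv : 0 ≤ v) :
    powExcess s v = v ^ 2 * (v ^ (s - 2) - (27 / 125) ^ (s - 2)) := by
  have : v ^ s = v ^ 2 * v ^ (s - 2) := by
    rw [← rpow_two, ← rpow_add_of_nonneg hv (by norm_num) (by linarith), add_sub_cancel]
  rw [powExcess, this]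
  ring

lemma powExcess_nonpos {s v : ℝ} (hs : 2 ≤ s) (hv : 0 ≤ v) (hv' : v ≤ 27 / 125) :
    powExcess s v ≤ 0 := by
  rw [powExcess_eq hs hv]
  have : v ^ (s - 2) ≤ (27 / 125) ^ (s - 2) := rpow_le_rpow hv hv' (by linarith)
  exact mul_nonpos_of_nonneg_of_nonpos (by positivity) (by linarith)

lemma powExcess_nonneg {s v : ℝ} (hs : 2 ≤ s) (hv : 27 / 125 ≤ v) : 0 ≤ powExcess s v := by
  rw [powExcess_eq hs (by linarith)]
  have : (27 / 125 : ℝ) ^ (s - 2) ≤ v ^ (s - 2) := rpow_le_rpow (by norm_num) hv (by linarith)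
  exact mul_nonneg (by positivity) (by linarith)

lemma powExcess_le {s v w : ℝ} (hs : 2 ≤ s) (hv : 0 ≤ v) (hw : 27 / 125 ≤ w) (h : v ≤ w) :
    powExcess s v ≤ powExcess s w := by
  rcases le_total v (27 / 125) with h1 | h1
  · exact (powExcess_nonpos hs hv h1).trans (powExcess_nonneg hs hw)
  · rw [powExcess_eq hs hv, powExcess_eq hs (hv.trans h)]
    have h2 : v ^ (s - 2) ≤ w ^ (s - 2) := rpow_le_rpow hv h (by linarith)
    have h3 : (27 / 125 : ℝ) ^ (s - 2) ≤ v ^ (s - 2) := rpow_le_rpow (by norm_num) h1 (by linarith)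
    exact mul_le_mul (by gcongr) (by linarith) (by linarith) (by positivity)

lemma integrableOn_rpow_mul_powExcess_exp {l s : ℝ} (hl : 0 < l) (hs : 2 ≤ s) :
    IntegrableOn (fun u => u ^ (l - 1) * powExcess s (exp (-u / 2))) (Ioi 0) ∧
    ∫ u in Ioi 0, u ^ (l - 1) * powExcess s (exp (-u / 2))
      = Gamma l * ((2 / s) ^ l - (27 / 125) ^ (s - 2)) := by
  have I : ∀ r : ℝ, 0 < r → IntegrableOn (fun u => u ^ (l - 1) * exp (-(r * u))) (Ioi 0) :=
    fun r hr => by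
      refine Integrable.of_integral_ne_zero ?_
      rw [Real.integral_rpow_mul_exp_neg_mul_Ioi hl hr]
      positivity
  have e : (fun u => u ^ (l - 1) * powExcess s (exp (-u / 2))) = fun u =>
      u ^ (l - 1) * exp (-(s / 2 * u)) - (27 / 125) ^ (s - 2) * (u ^ (l - 1) * exp (-(1 * u))) := by
    funext u
    rw [powExcess, ← exp_mul, ← exp_nat_mul]
    ring_nf
  have i1 := I (s / 2) (by linarith)
  have i2 := (I 1 one_pos).const_mul ((27 / 125) ^ (s - 2))
  rw [e]
  refine ⟨i1.sub i2, ?_⟩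
  rw [integral_sub i1 i2, integral_const_mul, Real.integral_rpow_mul_exp_neg_mul_Ioi hl (by linarith),
    Real.integral_rpow_mul_exp_neg_mul_Ioi hl one_pos]
  simp
  ring

lemma continuousOn_rpow_mul_powExcess_cube {l s : ℝ} (hl : 1 ≤ l) (hs : 2 ≤ s) :
    ContinuousOn (fun u => u ^ (l - 1) * powExcess s ((1 - u / 6) ^ 3)) (Icc 0 (12 / 5)) := by
  unfold powExcess
  refine ContinuousOn.mul (ContinuousOn.rpow_const (by fun_prop) fun _ _ => Or.inr (by linarith))
    (ContinuousOn.sub (ContinuousOn.rpow_const (by fun_prop) fun _ _ => Or.inr (by linarith))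
    (by fun_prop))

lemma integral_mul_powExcess_cube {s : ℝ} (hs : 2 ≤ s) :
    ∫ u in Ioc 0 (12 / 5), u * powExcess s ((1 - u / 6) ^ 3) ≤ 4 / s ^ 2 - (27 / 125) ^ (s - 2) := by
  refine le_trans (le_of_eq ?_) (polynomial_profile_le hs)
  rw [← integral_mul_one_sub_div_six_rpow (by linarith), ← integral_mul_one_sub_div_six_rpow
    (by norm_num), ← intervalIntegral.integral_const_mul, ← intervalIntegral.integral_sub,
    ← intervalIntegral.integral_of_le (by norm_num)]
  · refine intervalIntegral.integral_congr fun u hu => ?_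
    rw [uIcc_of_le (by norm_num)] at hu
    have hz : 0 ≤ 1 - u / 6 := by linarith [hu.2]
    simp only [powExcess]
    rw [← rpow_natCast (1 - u / 6) 3, ← rpow_mul hz, ← rpow_natCast _ 2, ← rpow_mul hz]
    norm_num
    ring
  · refine ContinuousOn.intervalIntegrable ?_
    exact continuousOn_id.mul (ContinuousOn.rpow_const (by fun_prop)
      fun u hu => Or.inr (by linarith))
  · refine ContinuousOn.intervalIntegrable ?_
    exact continuousOn_const.mul (continuousOn_id.mul (ContinuousOn.rpow_const (by fun_prop)
      fun u hu => Or.inr (by linarith)))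

lemma one_sub_div_six_pow_le_exp {u : ℝ} (hu : u ≤ 6) : (1 - u / 6) ^ 3 ≤ exp (-u / 2) := by
  have := pow_le_pow_left₀ (by linarith) (one_sub_le_exp_neg (u / 6)) 3
  rwa [← exp_nat_mul, show ((3 : ℕ) : ℝ) * -(u / 6) = -u / 2 by push_cast; ring] at this

/-- Comparison of the truncated polynomial profile with the Gaussian profile. -/
lemma integral_rpow_mul_powExcess_cube_le {l s : ℝ} (hl : 1 ≤ l) (hl' : l ≤ 2) (hs : 2 ≤ s) :
    ∫ u in Ioc 0 (12 / 5), u ^ (l - 1) * powExcess s ((1 - u / 6) ^ 3)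
      ≤ Gamma l * ((2 / s) ^ l - (27 / 125) ^ (s - 2)) := by
  obtain ⟨i1, e1⟩ := integrableOn_rpow_mul_powExcess_exp (l := l) (by linarith) hs
  obtain ⟨i2, e2⟩ := integrableOn_rpow_mul_powExcess_exp (l := 2) (by norm_num) hs
  rw [show (2 : ℝ) - 1 = 1 by norm_num] at i2 e2
  simp only [rpow_one] at i2 e2
  have j1 : IntegrableOn (fun u => u ^ (l - 1) * powExcess s ((1 - u / 6) ^ 3)) (Ioc 0 (12 / 5)) :=
    (continuousOn_rpow_mul_powExcess_cube hl hs).integrableOn_Icc.mono_set Ioc_subset_Icc_self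
  have j2 : IntegrableOn (fun u => u * powExcess s ((1 - u / 6) ^ 3)) (Ioc 0 (12 / 5)) := by
    have := continuousOn_rpow_mul_powExcess_cube (l := 2) (by norm_num) hs
    rw [show (2 : ℝ) - 1 = 1 by norm_num] at this
    simp only [rpow_one] at this
    exact this.integrableOn_Icc.mono_set Ioc_subset_Icc_self
  have hsub : Ioc (0 : ℝ) (12 / 5) ⊆ Ioi 0 := fun u hu => hu.1
  have ind : ∀ f : ℝ → ℝ, ∫ u in Ioc 0 (12 / 5), f u = ∫ u in Ioi 0, (Ioc 0 (12 / 5)).indicator f u :=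
    fun f => by
      rw [setIntegral_indicator measurableSet_Ioc, inter_eq_self_of_subset_right hsub]
  have iind : ∀ f : ℝ → ℝ, IntegrableOn f (Ioc 0 (12 / 5)) →
      IntegrableOn ((Ioc 0 (12 / 5)).indicator f) (Ioi 0) := fun f hf => by
    rw [IntegrableOn, integrable_indicator_iff measurableSet_Ioc, IntegrableOn,
      Measure.restrict_restrict measurableSet_Ioc, inter_eq_self_of_subset_left hsub]
    exact hf
  set c : ℝ := -2 * log (27 / 125) with hc
  have hc0 : 0 < c := by
    have := log_neg (x := 27 / 125) (by norm_num) (by norm_num)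
    linarith
  have hgc : ∀ u, u ≤ c ↔ 27 / 125 ≤ exp (-u / 2) := fun u => by
    rw [← log_le_iff_le_exp (by norm_num)]
    constructor <;> intro h <;> linarith
  have h2 := integral_mul_powExcess_cube hs
  have h3 : 0 ≤ ∫ u in Ioi 0, (u * powExcess s (exp (-u / 2))
      - (Ioc 0 (12 / 5)).indicator (fun u => u * powExcess s ((1 - u / 6) ^ 3)) u) := by
    rw [integral_sub i2 (iind _ j2), ← ind, e2, Gamma_two]
    norm_num [div_pow]
    norm_num at h2
    linarith
  have h4 : c ^ (l - 2) * ∫ u in Ioi 0, (u * powExcess s (exp (-u / 2))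
      - (Ioc 0 (12 / 5)).indicator (fun u => u * powExcess s ((1 - u / 6) ^ 3)) u)
      ≤ ∫ u in Ioi 0, (u ^ (l - 1) * powExcess s (exp (-u / 2))
      - (Ioc 0 (12 / 5)).indicator (fun u => u ^ (l - 1) * powExcess s ((1 - u / 6) ^ 3)) u) := by
    rw [← integral_const_mul]
    refine setIntegral_mono_on ((i2.sub (iind _ j2)).const_mul _) (i1.sub (iind _ j1))
      measurableSet_Ioi fun u hu => ?_
    have hu : 0 < u := hu
    have ew : u ^ (l - 1) = u ^ (l - 2) * u := by
      rw [← rpow_add_one hu.ne']; ring_nf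
    set q := powExcess s (exp (-u / 2))
      - (Ioc 0 (12 / 5)).indicator (fun u => powExcess s ((1 - u / 6) ^ 3)) u with hq
    have eq1 : u * powExcess s (exp (-u / 2))
      - (Ioc 0 (12 / 5)).indicator (fun u => u * powExcess s ((1 - u / 6) ^ 3)) u = u * q := by
      by_cases h : u ∈ Ioc 0 (12 / 5) <;> simp [hq, h, mul_sub]
    have eq2 : u ^ (l - 1) * powExcess s (exp (-u / 2))
      - (Ioc 0 (12 / 5)).indicator (fun u => u ^ (l - 1) * powExcess s ((1 - u / 6) ^ 3)) u
        = u ^ (l - 2) * (u * q) := by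
      rw [← mul_assoc, ← ew]
      by_cases h : u ∈ Ioc 0 (12 / 5) <;> simp [hq, h, mul_sub]
    rw [eq1, eq2]
    have hU : u ∈ Ioc 0 (12 / 5) → 27 / 125 ≤ (1 - u / 6) ^ 3 := fun h =>
      le_trans (by norm_num) (pow_le_pow_left₀ (by norm_num : (0 : ℝ) ≤ 3 / 5)
        (show 3 / 5 ≤ 1 - u / 6 by linarith [h.2]) 3)
    rcases le_or_gt u c with h | h
    · have hw : c ^ (l - 2) ≤ u ^ (l - 2) := rpow_le_rpow_of_nonpos hu h (by linarith)
      have hq0 : 0 ≤ q := by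
        by_cases h' : u ∈ Ioc 0 (12 / 5)
        · simp only [hq, indicator_of_mem h', sub_nonneg]
          exact powExcess_le hs (by linarith [hU h']) ((hgc u).1 h)
            (one_sub_div_six_pow_le_exp (by linarith [h'.2]))
        · simp only [hq, indicator_of_notMem h', sub_zero]
          exact powExcess_nonneg hs ((hgc u).1 h)
      exact mul_le_mul_of_nonneg_right hw (by positivity)
    · have hw : u ^ (l - 2) ≤ c ^ (l - 2) := rpow_le_rpow_of_nonpos hc0 h.le (by linarith)
      have hg : exp (-u / 2) < 27 / 125 := by
        by_contra! hcon
        exact absurd ((hgc u).2 hcon) (not_le.2 h)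
      have h' : u ∉ Ioc 0 (12 / 5) := fun h' => by
        linarith [hU h', one_sub_div_six_pow_le_exp (u := u) (by linarith [h'.2])]
      have hq0 : q ≤ 0 := by
        simp only [hq, indicator_of_notMem h', sub_zero]
        exact powExcess_nonpos hs (exp_pos _).le hg.le
      exact mul_le_mul_of_nonpos_right hw (mul_nonpos_of_nonneg_of_nonpos hu.le hq0)
  have h5 := (mul_nonneg (rpow_nonneg hc0.le (l - 2)) h3).trans h4
  rw [integral_sub i1 (iind _ j1), ← ind, e1] at h5
  linarith

/-- A Haagerup-type integral inequality for a profile `b` dominated by `(1 - u / 6) ^ 3` near `0`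
and by `27 / 125` away from `0`. -/
lemma lintegral_rpow_mul_rpow_le {l s : ℝ} (hl : 1 ≤ l) (hl' : l ≤ 2) (hs : 2 ≤ s) {b : ℝ → ℝ}
    (hb : Measurable b) (hb0 : ∀ u, 0 ≤ b u)
    (hb1 : ∀ u, 0 ≤ u → u ≤ 12 / 5 → b u ≤ (1 - u / 6) ^ 3)
    (hb2 : ∀ u, 12 / 5 ≤ u → b u ≤ 27 / 125)
    (hM : ENNReal.ofReal (Gamma l)
      ≤ ∫⁻ u in Ioi 0, ENNReal.ofReal (u ^ (l - 1)) * ENNReal.ofReal (b u) ^ (2 : ℝ)) :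
    ∫⁻ u in Ioi 0, ENNReal.ofReal (u ^ (l - 1)) * ENNReal.ofReal (b u) ^ s
      ≤ ENNReal.ofReal ((2 / s) ^ l) *
        ∫⁻ u in Ioi 0, ENNReal.ofReal (u ^ (l - 1)) * ENNReal.ofReal (b u) ^ (2 : ℝ) := by
  have hU : ∀ u ∈ Ioc (0 : ℝ) (12 / 5), 27 / 125 ≤ (1 - u / 6) ^ 3 := fun u h =>
    le_trans (by norm_num) (pow_le_pow_left₀ (by norm_num : (0 : ℝ) ≤ 3 / 5)
      (show 3 / 5 ≤ 1 - u / 6 by linarith [h.2]) 3)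
  have hle := integral_rpow_mul_powExcess_cube_le hl hl' hs
  have hnn : ∀ u ∈ Ioc (0 : ℝ) (12 / 5), 0 ≤ u ^ (l - 1) * powExcess s ((1 - u / 6) ^ 3) :=
    fun u hu => mul_nonneg (rpow_nonneg hu.1.le _) (powExcess_nonneg hs (hU u hu))
  have hG : 0 < Gamma l := Gamma_pos_of_pos (by linarith)
  have hR0 : (0 : ℝ) ≤ (27 / 125) ^ (s - 2) := by positivity
  have hbr : 0 ≤ (2 / s) ^ l - (27 / 125) ^ (s - 2) := by
    have := (setIntegral_nonneg measurableSet_Ioc hnn).trans hle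
    exact nonneg_of_mul_nonneg_right this hG
  set M := ∫⁻ u in Ioi 0, ENNReal.ofReal (u ^ (l - 1)) * ENNReal.ofReal (b u) ^ (2 : ℝ)
  calc ∫⁻ u in Ioi 0, ENNReal.ofReal (u ^ (l - 1)) * ENNReal.ofReal (b u) ^ s
      ≤ ∫⁻ u in Ioi 0, (ENNReal.ofReal ((27 / 125) ^ (s - 2)) *
          (ENNReal.ofReal (u ^ (l - 1)) * ENNReal.ofReal (b u) ^ (2 : ℝ))
        + (Ioc 0 (12 / 5)).indicator (fun u => ENNReal.ofReal
          (u ^ (l - 1) * powExcess s ((1 - u / 6) ^ 3))) u) := by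
        refine setLIntegral_mono' measurableSet_Ioi fun u hu => ?_
        have hu : 0 < u := hu
        have hw : 0 ≤ u ^ (l - 1) := rpow_nonneg hu.le _
        rw [ENNReal.ofReal_rpow_of_nonneg (hb0 u) (by linarith),
          ENNReal.ofReal_rpow_of_nonneg (hb0 u) (by norm_num), ← ENNReal.ofReal_mul hw,
          ← ENNReal.ofReal_mul hw, ← ENNReal.ofReal_mul hR0, rpow_two]
        have hk : b u ^ s = (27 / 125) ^ (s - 2) * b u ^ 2 + powExcess s (b u) := by
          rw [powExcess]; ring
        by_cases h : u ∈ Ioc 0 (12 / 5)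
        · rw [indicator_of_mem h, ← ENNReal.ofReal_add (by positivity) (hnn u h)]
          refine ENNReal.ofReal_le_ofReal ?_
          have := powExcess_le hs (hb0 u) (hU u h) (hb1 u h.1.le h.2)
          have := mul_le_mul_of_nonneg_left this hw
          rw [hk]
          linarith
        · rw [indicator_of_notMem h, add_zero]
          refine ENNReal.ofReal_le_ofReal ?_
          have h' : 12 / 5 ≤ u := by
            by_contra! hcon
            exact h ⟨hu, hcon.le⟩
          have := mul_nonpos_of_nonneg_of_nonpos hw (powExcess_nonpos hs (hb0 u) (hb2 u h'))
          rw [hk]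
          linarith
    _ = ENNReal.ofReal ((27 / 125) ^ (s - 2)) * M
        + ENNReal.ofReal (∫ u in Ioc 0 (12 / 5), u ^ (l - 1) * powExcess s ((1 - u / 6) ^ 3)) := by
        rw [lintegral_add_left (by fun_prop), lintegral_const_mul _ (by fun_prop),
          setLIntegral_indicator measurableSet_Ioc,
          inter_eq_self_of_subset_left Ioc_subset_Ioi_self,
          ofReal_integral_eq_lintegral_ofReal
            ((continuousOn_rpow_mul_powExcess_cube hl hs).integrableOn_Icc.mono_set
              Ioc_subset_Icc_self) (ae_restrict_of_forall_mem measurableSet_Ioc hnn)]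
    _ ≤ ENNReal.ofReal ((27 / 125) ^ (s - 2)) * M
        + ENNReal.ofReal ((2 / s) ^ l - (27 / 125) ^ (s - 2)) * M := by
        gcongr
        refine (ENNReal.ofReal_le_ofReal hle).trans ?_
        rw [mul_comm, ENNReal.ofReal_mul hbr]
        gcongr
    _ = _ := by
        rw [← add_mul, ← ENNReal.ofReal_add hR0 hbr, add_sub_cancel]

lemma lintegral_rpow_mul_exp_neg_mul {l A : ℝ} (hl : 0 < l) (hA : 0 ≤ A) :
    ∫⁻ s in Ioi (0 : ℝ), ENNReal.ofReal (s ^ (l - 1)) * ENNReal.ofReal (exp (-(s * A)))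
      = ENNReal.ofReal (Gamma l) * ENNReal.ofReal A ^ (-l) := by
  rcases hA.eq_or_lt with rfl | hA
  · rw [ENNReal.ofReal_zero, ENNReal.zero_rpow_of_neg (by linarith),
      ENNReal.mul_top (by simpa using Gamma_pos_of_pos hl)]
    by_contra h
    refine not_integrableOn_Ioi_rpow (l - 1) ⟨by fun_prop, ?_⟩
    rw [hasFiniteIntegral_iff_ofReal ((ae_restrict_mem measurableSet_Ioi).mono
      fun s hs => rpow_nonneg (le_of_lt hs) _)]
    simpa [lt_top_iff_ne_top] using h
  · have hi : IntegrableOn (fun s : ℝ => s ^ (l - 1) * exp (-(A * s))) (Ioi 0) := by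
      by_contra h
      have := Real.integral_rpow_mul_exp_neg_mul_Ioi hl hA
      rw [integral_undef h] at this
      have h2 : 0 < (1 / A) ^ l * Gamma l := mul_pos (by positivity) (Gamma_pos_of_pos hl)
      exact h2.ne this
    rw [ENNReal.ofReal_rpow_of_pos hA, ← ENNReal.ofReal_mul (Gamma_pos_of_pos hl).le]
    have : Gamma l * A ^ (-l) = ∫ s in Ioi (0 : ℝ), s ^ (l - 1) * exp (-(A * s)) := by
      rw [Real.integral_rpow_mul_exp_neg_mul_Ioi hl hA, rpow_neg hA.le, one_div, inv_rpow hA.le,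
        mul_comm]
    rw [this, ofReal_integral_eq_lintegral_ofReal hi ((ae_restrict_mem measurableSet_Ioi).mono
      fun s hs => mul_nonneg (rpow_nonneg (le_of_lt hs) _) (exp_pos _).le)]
    refine setLIntegral_congr_fun measurableSet_Ioi fun s hs => ?_
    rw [← ENNReal.ofReal_mul (rpow_nonneg (le_of_lt hs) _), mul_comm s A]

/-- `∫ s^(l-1) ψ(cs) ds = c^(-l) ∫ u^(l-1) ψ(u) du`. -/
lemma lintegral_rpow_mul_comp_mul {l c : ℝ} (hc : 0 < c) {ψ : ℝ → ℝ≥0∞} (hψ : Measurable ψ) :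
    ∫⁻ s in Ioi (0 : ℝ), ENNReal.ofReal (s ^ (l - 1)) * ψ (c * s)
      = ENNReal.ofReal c ^ (-l) * ∫⁻ u in Ioi (0 : ℝ), ENNReal.ofReal (u ^ (l - 1)) * ψ u := by
  have himg : (fun s => c * s) '' Ioi 0 = Ioi (0 : ℝ) := by
    simpa using image_mul_left_Ioi hc 0
  have h := lintegral_image_eq_lintegral_abs_deriv_mul measurableSet_Ioi
    (f := fun s => c * s) (f' := fun _ => c)
    (fun s _ => ((hasDerivAt_id s).const_mul c).hasDerivWithinAt.congr_deriv (mul_one c))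
    (mul_right_injective₀ hc.ne').injOn (fun u => ENNReal.ofReal (u ^ (l - 1)) * ψ u)
    (s := Ioi 0)
  rw [himg] at h
  rw [h, ← lintegral_const_mul _ (by fun_prop)]
  refine setLIntegral_congr_fun measurableSet_Ioi fun s hs => ?_
  rw [ENNReal.ofReal_rpow_of_pos hc, abs_of_pos hc, mul_rpow hc.le (le_of_lt hs),
    ← mul_assoc, ← mul_assoc, ← ENNReal.ofReal_mul (by positivity),
    ← ENNReal.ofReal_mul (by positivity)]
  congr 2
  rw [rpow_sub hc, rpow_one, rpow_neg hc.le]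
  field_simp

lemma lintegral_exp_neg_sq_norm_mul_rpow {l : ℝ} (hl : l < 2) :
    ∫⁻ v : EuclideanSpace ℝ (Fin 4),
        ENNReal.ofReal (exp (-‖v‖ ^ 2)) * ENNReal.ofReal (‖v‖ ^ 2) ^ (-l)
      = ENNReal.ofReal (π ^ 2 * Gamma (2 - l)) := by
  have hd : Module.finrank ℝ (EuclideanSpace ℝ (Fin 4)) = 4 := by simp
  have hcalc : ∫ v : EuclideanSpace ℝ (Fin 4), exp (-‖v‖ ^ 2) * ‖v‖ ^ (-2 * l)
      = π ^ 2 * Gamma (2 - l) := by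
    have hb : (volume : Measure (EuclideanSpace ℝ (Fin 4))).real (Metric.ball 0 1) = π ^ 2 / 2 := by
      rw [Measure.real, InnerProductSpace.volume_ball_of_dim_even (k := 2) (by simp)]
      rw [ENNReal.ofReal_one, one_pow, one_mul, ENNReal.toReal_ofReal (by positivity)]
      norm_num [Nat.factorial]
    rw [integral_fun_norm_addHaar volume (fun y => exp (-y ^ 2) * y ^ (-2 * l)), hb, hd]
    have : ∫ y in Ioi (0 : ℝ), y ^ (4 - 1) • (exp (-y ^ 2) * y ^ (-2 * l))
        = 1 / 2 * Gamma (2 - l) := by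
      have h := integral_rpow_mul_exp_neg_rpow (p := 2) (q := 3 - 2 * l) (by norm_num) (by linarith)
      rw [show (3 - 2 * l + 1) / 2 = 2 - l by ring] at h
      rw [← h]
      refine setIntegral_congr_fun measurableSet_Ioi fun y hy => ?_
      simp only [smul_eq_mul]
      rw [sub_eq_add_neg, rpow_add hy, ← neg_mul, rpow_two,
        show y ^ (3 : ℝ) = y ^ 3 by exact_mod_cast rpow_natCast y 3]
      ring
    rw [this]
    simp only [nsmul_eq_mul, smul_eq_mul]
    push_cast
    ring
  have hi : Integrable fun v : EuclideanSpace ℝ (Fin 4) => exp (-‖v‖ ^ 2) * ‖v‖ ^ (-2 * l) := by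
    by_contra h
    rw [integral_undef h] at hcalc
    have : 0 < π ^ 2 * Gamma (2 - l) := by positivity
    exact this.ne hcalc
  rw [← hcalc, ofReal_integral_eq_lintegral_ofReal hi (ae_of_all _ fun v => by positivity)]
  refine lintegral_congr_ae ?_
  filter_upwards [Measure.ae_ne volume (0 : EuclideanSpace ℝ (Fin 4))] with v hv
  have hv' : 0 < ‖v‖ := norm_pos_iff.2 hv
  rw [ENNReal.ofReal_rpow_of_pos (by positivity), ← ENNReal.ofReal_mul (by positivity),
    ← rpow_natCast, ← rpow_mul hv'.le]
  norm_num

/-- The Laplace transform of `‖x‖²` as a Gaussian average of the characteristic function. -/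
lemma integral_exp_neg_mul_sq_norm_eq {ν : Measure (EuclideanSpace ℝ (Fin 4))}
    [IsProbabilityMeasure ν] {G : ℝ → ℝ} (hG : ∀ v, charFun ν v = G (‖v‖ ^ 2 / 4))
    {s : ℝ} (hs : 0 ≤ s) :
    π ^ 2 * ∫ x, exp (-(s * ‖x‖ ^ 2)) ∂ν
      = ∫ v : EuclideanSpace ℝ (Fin 4), exp (-‖v‖ ^ 2) * G (‖v‖ ^ 2 * s) := by
  have hone : (0 : ℝ) < (1 : ℂ).re := by simp
  have key (x : EuclideanSpace ℝ (Fin 4)) : ((π ^ 2 * exp (-(s * ‖x‖ ^ 2)) : ℝ) : ℂ)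
      = ∫ v : EuclideanSpace ℝ (Fin 4), Complex.exp (-‖v‖ ^ 2)
          * Complex.exp (inner ℝ x ((2 * √s) • v) * Complex.I) := by
    have h := GaussianFourier.integral_cexp_neg_mul_sq_norm_add (V := EuclideanSpace ℝ (Fin 4))
      hone (2 * √s * Complex.I) x
    have hsq : ((√s : ℝ) : ℂ) ^ 2 = s := by exact_mod_cast sq_sqrt hs
    have e1 : ((π : ℂ) / 1) ^ ((Module.finrank ℝ (EuclideanSpace ℝ (Fin 4)) : ℂ) / 2)
        = (π : ℂ) ^ 2 := by
      rw [div_one]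
      norm_num [finrank_euclideanSpace]
    have e2 : (2 * (√s : ℂ) * Complex.I) ^ 2 * (‖x‖ : ℂ) ^ 2 / (4 * 1)
        = ((-(s * ‖x‖ ^ 2) : ℝ) : ℂ) := by
      rw [mul_pow, mul_pow, hsq, Complex.I_sq]
      push_cast
      ring
    rw [e1, e2] at h
    push_cast at h ⊢
    rw [← h]
    refine integral_congr_ae (ae_of_all _ fun v => ?_)
    simp only
    rw [← Complex.exp_add, real_inner_smul_right]
    push_cast
    ring_nf
  have h_int : Integrable (Function.uncurry fun (x v : EuclideanSpace ℝ (Fin 4)) =>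
      Complex.exp (-‖v‖ ^ 2) * Complex.exp (inner ℝ x ((2 * √s) • v) * Complex.I))
      (ν.prod volume) := by
    have hg : Integrable (fun v : EuclideanSpace ℝ (Fin 4) => Complex.exp (-‖v‖ ^ 2)) := by
      simpa using GaussianFourier.integrable_cexp_neg_mul_sq_norm_add
        (V := EuclideanSpace ℝ (Fin 4)) hone 0 0
    refine (hg.comp_snd ν).mono (Continuous.aestronglyMeasurable ?_) (ae_of_all _ fun z => ?_)
    · simp only [Function.uncurry_def]
      fun_prop
    · simp [Function.uncurry_def, Complex.norm_exp]
  have hc : ((π ^ 2 * ∫ x, exp (-(s * ‖x‖ ^ 2)) ∂ν : ℝ) : ℂ)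
      = ((∫ v : EuclideanSpace ℝ (Fin 4), exp (-‖v‖ ^ 2) * G (‖v‖ ^ 2 * s) : ℝ) : ℂ) := by
    rw [← integral_const_mul, ← integral_complex_ofReal, integral_congr_ae (ae_of_all _ key),
      integral_integral_swap h_int, ← integral_complex_ofReal]
    refine integral_congr_ae (ae_of_all _ fun v => ?_)
    simp only
    rw [integral_const_mul, ← charFun_apply, hG, norm_smul, mul_pow, norm_of_nonneg (by positivity),
      mul_pow, sq_sqrt hs, show 2 ^ 2 * s * ‖v‖ ^ 2 / 4 = ‖v‖ ^ 2 * s by ring]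
    push_cast
    rfl
  exact_mod_cast hc

lemma lintegral_rpow_mul_lintegral_exp_neg_mul_sq_norm {ν : Measure (EuclideanSpace ℝ (Fin 4))}
    [IsProbabilityMeasure ν] {l : ℝ} (hl : 0 < l) :
    ∫⁻ s in Ioi (0 : ℝ), ENNReal.ofReal (s ^ (l - 1))
        * ∫⁻ x, ENNReal.ofReal (exp (-(s * ‖x‖ ^ 2))) ∂ν
      = ENNReal.ofReal (Gamma l) * ∫⁻ x, ENNReal.ofReal (‖x‖ ^ 2) ^ (-l) ∂ν := by
  rw [← lintegral_const_mul _ (by fun_prop)]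
  simp_rw [← lintegral_rpow_mul_exp_neg_mul hl (sq_nonneg _)]
  rw [lintegral_lintegral_swap (by fun_prop)]
  refine lintegral_congr fun s => ?_
  rw [lintegral_const_mul _ (by fun_prop)]

lemma lintegral_rpow_mul_lintegral_exp_neg_sq_norm_mul {l : ℝ} (hl : l < 2) {ψ : ℝ → ℝ≥0∞}
    (hψ : Measurable ψ) :
    ∫⁻ s in Ioi (0 : ℝ), ENNReal.ofReal (s ^ (l - 1))
        * ∫⁻ v : EuclideanSpace ℝ (Fin 4), ENNReal.ofReal (exp (-‖v‖ ^ 2)) * ψ (‖v‖ ^ 2 * s)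
      = ENNReal.ofReal (π ^ 2) * (ENNReal.ofReal (Gamma (2 - l))
        * ∫⁻ u in Ioi (0 : ℝ), ENNReal.ofReal (u ^ (l - 1)) * ψ u) := by
  have hm (s : ℝ) : Measurable fun v : EuclideanSpace ℝ (Fin 4) =>
      ENNReal.ofReal (exp (-‖v‖ ^ 2)) * ψ (‖v‖ ^ 2 * s) := by fun_prop
  simp_rw [← lintegral_const_mul _ (hm _)]
  rw [lintegral_lintegral_swap (by fun_prop), ← mul_assoc, ← ENNReal.ofReal_mul (by positivity),
    ← lintegral_exp_neg_sq_norm_mul_rpow hl, ← lintegral_mul_const _ (by fun_prop)]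
  refine lintegral_congr_ae ?_
  filter_upwards [Measure.ae_ne volume (0 : EuclideanSpace ℝ (Fin 4))] with v hv
  rw [mul_assoc, ← lintegral_rpow_mul_comp_mul (by positivity) hψ,
    ← lintegral_const_mul _ (by fun_prop)]
  exact lintegral_congr fun s => mul_left_comm _ _ _

lemma ofReal_pi_sq_mul_lintegral_exp_neg_mul_sq_norm {ν : Measure (EuclideanSpace ℝ (Fin 4))}
    [IsProbabilityMeasure ν] {G : ℝ → ℝ} (hG : ∀ v, charFun ν v = G (‖v‖ ^ 2 / 4))
    {s : ℝ} (hs : 0 ≤ s) :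
    ENNReal.ofReal (π ^ 2) * ∫⁻ x, ENNReal.ofReal (exp (-(s * ‖x‖ ^ 2))) ∂ν
      = ENNReal.ofReal (∫ v : EuclideanSpace ℝ (Fin 4), exp (-‖v‖ ^ 2) * G (‖v‖ ^ 2 * s)) := by
  rw [← integral_exp_neg_mul_sq_norm_eq hG hs, ENNReal.ofReal_mul (by positivity),
    ofReal_integral_eq_lintegral_ofReal _ (ae_of_all _ fun x => (exp_pos _).le)]
  refine Integrable.of_bound (by fun_prop) 1 (ae_of_all _ fun x => ?_)
  rw [norm_of_nonneg (exp_pos _).le, exp_le_one_iff]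
  exact neg_nonpos.2 (by positivity)

lemma lintegral_sq_norm_rpow_le {ν : Measure (EuclideanSpace ℝ (Fin 4))}
    [IsProbabilityMeasure ν] {G : ℝ → ℝ} (hG : ∀ v, charFun ν v = G (‖v‖ ^ 2 / 4))
    (hGm : Measurable G) {l : ℝ} (hl : 0 < l) (hl' : l < 2) :
    ENNReal.ofReal (Gamma l) * ∫⁻ x, ENNReal.ofReal (‖x‖ ^ 2) ^ (-l) ∂ν
      ≤ ENNReal.ofReal (Gamma (2 - l))
        * ∫⁻ u in Ioi (0 : ℝ), ENNReal.ofReal (u ^ (l - 1)) * ENNReal.ofReal |G u| := by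
  have hpi : ENNReal.ofReal (π ^ 2) ≠ 0 := by simp
  rw [← ENNReal.mul_le_mul_iff_right hpi ENNReal.ofReal_ne_top,
    ← lintegral_rpow_mul_lintegral_exp_neg_sq_norm_mul hl'
      (ψ := fun u => ENNReal.ofReal |G u|) (by fun_prop),
    ← lintegral_rpow_mul_lintegral_exp_neg_mul_sq_norm hl,
    ← lintegral_const_mul' _ _ ENNReal.ofReal_ne_top]
  refine setLIntegral_mono' measurableSet_Ioi fun s hs => ?_
  rw [mul_left_comm, ofReal_pi_sq_mul_lintegral_exp_neg_mul_sq_norm hG (le_of_lt hs)]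
  gcongr
  refine (Real.ofReal_le_enorm _).trans ((enorm_integral_le_lintegral_enorm _).trans_eq ?_)
  refine lintegral_congr fun v => ?_
  rw [Real.enorm_eq_ofReal_abs, abs_mul, abs_of_pos (exp_pos _),
    ENNReal.ofReal_mul (exp_pos _).le]

lemma lintegral_sq_norm_rpow_eq {ν : Measure (EuclideanSpace ℝ (Fin 4))}
    [IsProbabilityMeasure ν] {G : ℝ → ℝ} (hG : ∀ v, charFun ν v = G (‖v‖ ^ 2 / 4))
    (hGm : Measurable G) (hG0 : ∀ u, 0 ≤ G u) (hG1 : ∀ u, G u ≤ 1) {l : ℝ} (hl : 0 < l)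
    (hl' : l < 2) :
    ENNReal.ofReal (Gamma l) * ∫⁻ x, ENNReal.ofReal (‖x‖ ^ 2) ^ (-l) ∂ν
      = ENNReal.ofReal (Gamma (2 - l))
        * ∫⁻ u in Ioi (0 : ℝ), ENNReal.ofReal (u ^ (l - 1)) * ENNReal.ofReal (G u) := by
  have hpi : ENNReal.ofReal (π ^ 2) ≠ 0 := by simp
  have hgauss : Integrable fun v : EuclideanSpace ℝ (Fin 4) => exp (-‖v‖ ^ 2) := by
    simpa [Complex.norm_exp, ← Complex.ofReal_pow] using
      (GaussianFourier.integrable_cexp_neg_mul_sq_norm_add (V := EuclideanSpace ℝ (Fin 4))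
        (b := 1) (by simp) 0 0).norm
  have h_int (s : ℝ) : Integrable fun v : EuclideanSpace ℝ (Fin 4) =>
      exp (-‖v‖ ^ 2) * G (‖v‖ ^ 2 * s) := by
    refine hgauss.mul_bdd (c := 1) (Measurable.aestronglyMeasurable (by fun_prop))
      (ae_of_all _ fun v => ?_)
    rw [norm_of_nonneg (hG0 _)]
    exact hG1 _
  rw [← ENNReal.mul_right_inj hpi ENNReal.ofReal_ne_top,
    ← lintegral_rpow_mul_lintegral_exp_neg_sq_norm_mul hl'
      (ψ := fun u => ENNReal.ofReal (G u)) (by fun_prop),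
    ← lintegral_rpow_mul_lintegral_exp_neg_mul_sq_norm hl,
    ← lintegral_const_mul' _ _ ENNReal.ofReal_ne_top]
  refine setLIntegral_congr_fun measurableSet_Ioi fun s hs => ?_
  rw [mul_left_comm, ofReal_pi_sq_mul_lintegral_exp_neg_mul_sq_norm hG (le_of_lt hs),
    ofReal_integral_eq_lintegral_ofReal (h_int s)
      (ae_of_all _ fun v => mul_nonneg (exp_pos _).le (hG0 _))]
  simp_rw [ENNReal.ofReal_mul (exp_pos _).le]

section SphereSums

variable {μ : Measure (EuclideanSpace ℝ (Fin 4))}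

lemma IsUniformOnSphere.lintegral_sq_norm_add_rpow (hμ : IsUniformOnSphere μ) (l : ℝ)
    (y : EuclideanSpace ℝ (Fin 4)) :
    ∫⁻ x, ENNReal.ofReal (‖x + y‖ ^ 2) ^ (-l) ∂μ
      = ∫⁻ t, ENNReal.ofReal (1 + ‖y‖ ^ 2 + 2 * ‖y‖ * t) ^ (-l) ∂(μ.map fun x => x 0) := by
  have h : ∫⁻ x, ENNReal.ofReal (‖x + y‖ ^ 2) ^ (-l) ∂μ
      = ∫⁻ t, ENNReal.ofReal (1 + ‖y‖ ^ 2 + 2 * t) ^ (-l) ∂(μ.map fun x => inner ℝ x y) := by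
    rw [lintegral_map (by fun_prop) (by fun_prop)]
    refine lintegral_congr_ae (hμ.ae_norm_eq_one.mono fun x hx => ?_)
    simp only
    rw [norm_add_sq_real, hx, one_pow, add_right_comm]
  rw [h, hμ.map_inner_eq_coord, lintegral_map (by fun_prop) (by fun_prop)]
  simp_rw [mul_assoc]

lemma ofReal_sq_norm_smul_add_rpow {a : ℝ} (ha : a ≠ 0) (l : ℝ) (x y : EuclideanSpace ℝ (Fin 4)) :
    ENNReal.ofReal (‖a • x + y‖ ^ 2) ^ (-l)
      = ENNReal.ofReal (a ^ 2) ^ (-l) * ENNReal.ofReal (‖x + a⁻¹ • y‖ ^ 2) ^ (-l) := by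
  rw [← ENNReal.mul_rpow_of_ne_top ENNReal.ofReal_ne_top ENNReal.ofReal_ne_top,
    ← ENNReal.ofReal_mul (sq_nonneg a)]
  congr 2
  rw [← sq_abs a, ← mul_pow, ← Real.norm_eq_abs, ← norm_smul, smul_add, smul_inv_smul₀ ha]

variable [IsProbabilityMeasure μ]

lemma IsUniformOnSphere.lintegral_sq_norm_smul_add_rpow_le (hμ : IsUniformOnSphere μ) {l : ℝ}
    (hl : 1 ≤ l) (hl' : l < 3 / 2) {a : ℝ} (ha : a ≠ 0) (y : EuclideanSpace ℝ (Fin 4)) :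
    ∫⁻ x, ENNReal.ofReal (‖a • x + y‖ ^ 2) ^ (-l) ∂μ
      ≤ ENNReal.ofReal (a ^ 2) ^ (-l)
        * ENNReal.ofReal (Gamma (3 - 2 * l) / (Gamma (2 - l) * Gamma (3 - l))) := by
  simp_rw [ofReal_sq_norm_smul_add_rpow ha]
  rw [lintegral_const_mul _ (by fun_prop), hμ.lintegral_sq_norm_add_rpow]
  have := Measure.isProbabilityMeasure_map (μ := μ) (f := fun x => x 0) (by fun_prop)
  gcongr
  exact hμ.semicircleIdentity.lintegral_rpow_le hl hl' (norm_nonneg _)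

lemma IsUniformOnSphere.lintegral_sq_norm_smul_add_rpow_eq (hμ : IsUniformOnSphere μ) {l : ℝ}
    (hl : l < 3 / 2) {a : ℝ} (ha : a ≠ 0) {y : EuclideanSpace ℝ (Fin 4)} (hy : ‖y‖ = 1) :
    ∫⁻ x, ENNReal.ofReal (‖a • x + a • y‖ ^ 2) ^ (-l) ∂μ
      = ENNReal.ofReal (a ^ 2) ^ (-l)
        * ENNReal.ofReal (Gamma (3 - 2 * l) / (Gamma (2 - l) * Gamma (3 - l))) := by
  simp_rw [ofReal_sq_norm_smul_add_rpow ha, inv_smul_smul₀ ha]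
  rw [lintegral_const_mul _ (by fun_prop), hμ.lintegral_sq_norm_add_rpow, hy]
  have := Measure.isProbabilityMeasure_map (μ := μ) (f := fun x => x 0) (by fun_prop)
  rw [← hμ.semicircleIdentity.lintegral_rpow_two_add hl]
  norm_num

lemma lintegral_pi_comp_sum_smul {n : ℕ} (a : Fin (n + 1) → ℝ) (k : Fin (n + 1))
    {F : EuclideanSpace ℝ (Fin 4) → ℝ≥0∞} (hF : Measurable F) :
    ∫⁻ x, F (∑ i, a i • x i) ∂(Measure.pi fun _ : Fin (n + 1) => μ)
      = ∫⁻ z, ∫⁻ x, F (a k • x + ∑ j, a (k.succAbove j) • z j) ∂μ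
        ∂(Measure.pi fun _ : Fin n => μ) := by
  have h := measurePreserving_piFinSuccAbove (fun _ : Fin (n + 1) => μ) k
  rw [← lintegral_prod_symm (fun q : _ × (Fin n → EuclideanSpace ℝ (Fin 4)) =>
      F (a k • q.1 + ∑ j, a (k.succAbove j) • q.2 j)) (by fun_prop),
    ← h.lintegral_comp (by fun_prop)]
  simp [Fin.sum_univ_succAbove _ k, Fin.removeNth]

lemma IsUniformOnSphere.lintegral_sq_norm_sum_rpow_le_of_coeff (hμ : IsUniformOnSphere μ)
    {l : ℝ} (hl : 1 ≤ l) (hl' : l < 3 / 2) {n : ℕ} (a : Fin (n + 1) → ℝ) {k : Fin (n + 1)}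
    (hk : a k ≠ 0) :
    ∫⁻ x, ENNReal.ofReal (‖∑ i, a i • x i‖ ^ 2) ^ (-l) ∂(Measure.pi fun _ : Fin (n + 1) => μ)
      ≤ ENNReal.ofReal (a k ^ 2) ^ (-l)
        * ENNReal.ofReal (Gamma (3 - 2 * l) / (Gamma (2 - l) * Gamma (3 - l))) := by
  rw [lintegral_pi_comp_sum_smul a k (F := fun v => ENNReal.ofReal (‖v‖ ^ 2) ^ (-l)) (by fun_prop)]
  refine (lintegral_mono fun z => hμ.lintegral_sq_norm_smul_add_rpow_le hl hl' hk _).trans_eq ?_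
  simp

lemma IsUniformOnSphere.lintegral_sq_norm_sum_two_rpow (hμ : IsUniformOnSphere μ)
    {l : ℝ} (hl : l < 3 / 2) {c : ℝ} (hc : c ≠ 0) :
    ∫⁻ x, ENNReal.ofReal (‖∑ i, c • x i‖ ^ 2) ^ (-l) ∂(Measure.pi fun _ : Fin 2 => μ)
      = ENNReal.ofReal (c ^ 2) ^ (-l)
        * ENNReal.ofReal (Gamma (3 - 2 * l) / (Gamma (2 - l) * Gamma (3 - l))) := by
  rw [lintegral_pi_comp_sum_smul (fun _ => c) 0 (F := fun v => ENNReal.ofReal (‖v‖ ^ 2) ^ (-l))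
    (by fun_prop)]
  have hz : ∀ᵐ z ∂(Measure.pi fun _ : Fin 1 => μ), ‖z 0‖ = 1 :=
    (Measure.quasiMeasurePreserving_eval (μ := fun _ : Fin 1 => μ) 0).ae hμ.ae_norm_eq_one
  rw [lintegral_congr_ae (hz.mono fun z hz => by
    simpa using hμ.lintegral_sq_norm_smul_add_rpow_eq hl hc hz)]
  simp

/-- The characteristic function of `a ξ` at `v`, as a function of `u = a² ‖v‖² / 4`, where `τ` is
the law of a coordinate of `ξ`. -/
noncomputable def cosTransform (τ : Measure ℝ) (u : ℝ) : ℝ := ∫ x, cos (2 * √u * x) ∂τ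

lemma measurable_cosTransform (τ : Measure ℝ) [SFinite τ] : Measurable (cosTransform τ) :=
  (Measurable.stronglyMeasurable (by fun_prop)).integral_prod_right.measurable

lemma IsUniformOnSphere.charFun_eq (hμ : IsUniformOnSphere μ) (v : EuclideanSpace ℝ (Fin 4)) :
    charFun μ v = cosTransform (μ.map fun x => x 0) (‖v‖ ^ 2 / 4) := by
  set τ := μ.map fun x => x 0 with hτ
  have h (w : EuclideanSpace ℝ (Fin 4)) : charFun μ w = charFun τ ‖w‖ := by
    have h1 : charFun μ w = ∫ t : ℝ, Complex.exp (t * Complex.I) ∂(μ.map fun x => inner ℝ x w) := by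
      rw [charFun_apply, integral_map (by fun_prop) (by fun_prop)]
    rw [h1, hμ.map_inner_eq_coord, integral_map (by fun_prop) (by fun_prop), charFun_apply_real]
    push_cast
    rfl
  have hconj : (starRingEnd ℂ) (charFun μ v) = charFun μ v := by
    rw [← charFun_neg, h, h, norm_neg]
  obtain ⟨r, hr⟩ := Complex.conj_eq_iff_real.1 hconj
  have hre : (charFun μ v).re = cosTransform τ (‖v‖ ^ 2 / 4) := by
    have hs : 2 * √(‖v‖ ^ 2 / 4) = ‖v‖ := by
      rw [show ‖v‖ ^ 2 / 4 = (‖v‖ / 2) ^ 2 by ring, sqrt_sq (by positivity)]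
      ring
    rw [h, charFun_apply_real, cosTransform, hs]
    have hi : Integrable (fun t : ℝ => Complex.exp (‖v‖ * t * Complex.I)) τ := by
      refine Integrable.of_bound (by fun_prop) 1 (ae_of_all _ fun t => ?_)
      rw [← Complex.ofReal_mul, Complex.norm_exp_ofReal_mul_I]
    have h2 := integral_re hi
    simp only [RCLike.re_eq_complex_re] at h2
    rw [← h2]
    refine integral_congr_ae (ae_of_all _ fun t => ?_)
    simp only
    rw [← Complex.ofReal_mul, Complex.exp_ofReal_mul_I_re]
  rw [← hre, hr, Complex.ofReal_re]

lemma IsUniformOnSphere.charFun_map_sum_smul (hμ : IsUniformOnSphere μ) {n : ℕ} (a : Fin n → ℝ)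
    (v : EuclideanSpace ℝ (Fin 4)) :
    charFun ((Measure.pi fun _ : Fin n => μ).map fun x => ∑ k, a k • x k) v
      = ((∏ k, cosTransform (μ.map fun x => x 0) (a k ^ 2 * (‖v‖ ^ 2 / 4)) : ℝ) : ℂ) := by
  have hX : iIndepFun (fun k (x : Fin n → EuclideanSpace ℝ (Fin 4)) => a k • x k)
      (Measure.pi fun _ : Fin n => μ) :=
    iIndepFun_pi (μ := fun _ : Fin n => μ) (X := fun k x => a k • x) fun k =>
      (measurable_const_smul (a k)).aemeasurable
  have hm (k : Fin n) : AEMeasurable (fun x : Fin n → EuclideanSpace ℝ (Fin 4) => a k • x k)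
      (Measure.pi fun _ : Fin n => μ) :=
    ((measurable_pi_apply k).const_smul (a k)).aemeasurable
  rw [hX.charFun_map_fun_sum_eq_prod hm, Finset.prod_apply, Complex.ofReal_prod]
  refine Finset.prod_congr rfl fun k _ => ?_
  have he : (Measure.pi fun _ : Fin n => μ).map (fun x => x k) = μ :=
    (measurePreserving_eval (fun _ : Fin n => μ) k).map_eq
  rw [charFun_map_smul_comp (f := fun x : Fin n → EuclideanSpace ℝ (Fin 4) => x k) 
    (measurable_pi_apply k).aemeasurable, he, hμ.charFun_eq, norm_smul,
    mul_pow, Real.norm_eq_abs,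
    sq_abs, mul_div_assoc]

end SphereSums

lemma ENNReal.prod_rpow_eq_rpow_sum {ι : Type*} (s : Finset ι) (w : ι → ℝ)
    (hw : ∀ i ∈ s, 0 ≤ w i) (x : ℝ≥0∞) : ∏ i ∈ s, x ^ w i = x ^ ∑ i ∈ s, w i := by
  classical
  induction s using Finset.induction_on with
  | empty => simp
  | insert i s hi ih =>
    have hs : ∀ j ∈ s, 0 ≤ w j := fun j hj => hw j (Finset.mem_insert_of_mem hj)
    rw [Finset.prod_insert hi, Finset.sum_insert hi, ih hs, ENNReal.rpow_add_of_nonneg _ _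
      (hw i (Finset.mem_insert_self i s)) (Finset.sum_nonneg hs)]

lemma Gamma_two_sub_le {l : ℝ} (hl : 1 ≤ l) (hl' : l < 3 / 2) :
    Gamma (2 - l) ≤ Gamma (3 - 2 * l) / (Gamma (2 - l) * Gamma (3 - l)) := by
  have h0 : 0 < Gamma (3 - 2 * l) := Gamma_pos_of_pos (by linarith)
  have h1 : 0 < Gamma (2 - l) := Gamma_pos_of_pos (by linarith)
  have h2 : 0 < Gamma (3 - l) := Gamma_pos_of_pos (by linarith)
  have hsq : Gamma (2 - l) ^ 2 ≤ Gamma (3 - 2 * l) := by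
    have h := convexOn_log_Gamma.2 (mem_Ioi.2 (by linarith : 0 < 3 - 2 * l)) (mem_Ioi.2 one_pos)
      one_half_pos.le one_half_pos.le (add_halves 1)
    simp only [Function.comp_apply, smul_eq_mul, Gamma_one, log_one, mul_zero, add_zero] at h
    rw [show 1 / 2 * (3 - 2 * l) + 1 / 2 * 1 = 2 - l by ring] at h
    rw [← log_le_log_iff (by positivity) h0, log_pow]
    push_cast
    linarith
  have hle : Gamma (3 - l) ≤ 1 := by
    have h := convexOn_Gamma.2 (mem_Ioi.2 one_pos) (mem_Ioi.2 two_pos) (sub_nonneg.2 hl)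
      (by linarith : 0 ≤ 2 - l) (by ring)
    simp only [smul_eq_mul, Gamma_one, Gamma_two] at h
    rw [show (l - 1) * 1 + (2 - l) * 2 = 3 - l by ring] at h
    linarith
  rw [le_div_iff₀ (by positivity)]
  nlinarith

lemma abs_cosTransform_le_one (τ : Measure ℝ) [IsProbabilityMeasure τ] (u : ℝ) :
    |cosTransform τ u| ≤ 1 := SemicircleIdentity.abs_integral_cos_le_one _

lemma cosTransform_zero (τ : Measure ℝ) [IsProbabilityMeasure τ] : cosTransform τ 0 = 1 := by
  simp [cosTransform]

/-- `E|ξ₁ + ξ₂|^(-2l)` by Fourier inversion. -/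
lemma IsUniformOnSphere.lintegral_sq_cosTransform {μ : Measure (EuclideanSpace ℝ (Fin 4))}
    [IsProbabilityMeasure μ] (hμ : IsUniformOnSphere μ) {l : ℝ} (hl : 0 < l) (hl' : l < 3 / 2) :
    ENNReal.ofReal (Gamma l)
        * ENNReal.ofReal (Gamma (3 - 2 * l) / (Gamma (2 - l) * Gamma (3 - l)))
      = ENNReal.ofReal (Gamma (2 - l)) * ∫⁻ u in Ioi (0 : ℝ), ENNReal.ofReal (u ^ (l - 1))
        * ENNReal.ofReal |cosTransform (μ.map fun x => x 0) u| ^ (2 : ℝ) := by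
  set τ := μ.map fun x => x 0 with hτ
  have : IsProbabilityMeasure τ := Measure.isProbabilityMeasure_map (by fun_prop)
  have : IsProbabilityMeasure ((Measure.pi fun _ : Fin 2 => μ).map fun x => ∑ k, (1 : ℝ) • x k) :=
    Measure.isProbabilityMeasure_map (Measurable.aemeasurable (by fun_prop))
  have h := lintegral_sq_norm_rpow_eq
    (ν := (Measure.pi fun _ : Fin 2 => μ).map fun x => ∑ k, (1 : ℝ) • x k)
    (G := fun u => |cosTransform τ u| ^ 2)
    (fun v => by
      rw [hμ.charFun_map_sum_smul (fun _ => 1)]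
      simp [pow_two, hτ])
    (by have := measurable_cosTransform τ; fun_prop) (fun u => by positivity)
    (fun u => pow_le_one₀ (abs_nonneg _) (abs_cosTransform_le_one τ u)) hl (by linarith)
  rw [lintegral_map (by fun_prop) (by fun_prop), hμ.lintegral_sq_norm_sum_two_rpow hl' one_ne_zero]
    at h
  simp only [one_pow, ENNReal.ofReal_one, ENNReal.one_rpow, one_mul] at h
  rw [h]
  simp_rw [ENNReal.ofReal_pow (abs_nonneg _), ENNReal.rpow_two]

/-- Hölder's inequality when no coefficient dominates. -/
lemma IsUniformOnSphere.lintegral_prod_cosTransform_le {μ : Measure (EuclideanSpace ℝ (Fin 4))}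
    [IsProbabilityMeasure μ] (hμ : IsUniformOnSphere μ) {l : ℝ} (hl : 1 ≤ l) (hl' : l < 3 / 2)
    {n : ℕ} (a : Fin n → ℝ) {σ : ℝ} (hσ : 0 < σ) (ha : ∑ k, a k ^ 2 = σ)
    (hle : ∀ k, a k ^ 2 ≤ σ / 2) :
    ∫⁻ u in Ioi (0 : ℝ), ENNReal.ofReal (u ^ (l - 1))
        * ENNReal.ofReal |∏ k, cosTransform (μ.map fun x => x 0) (a k ^ 2 * u)|
      ≤ ENNReal.ofReal ((2 / σ) ^ l) * ∫⁻ u in Ioi (0 : ℝ), ENNReal.ofReal (u ^ (l - 1))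
        * ENNReal.ofReal |cosTransform (μ.map fun x => x 0) u| ^ (2 : ℝ) := by
  set τ := μ.map fun x => x 0 with hτ
  have : IsProbabilityMeasure τ := Measure.isProbabilityMeasure_map (by fun_prop)
  have hτs : SemicircleIdentity τ := hμ.semicircleIdentity
  have hB : Measurable (cosTransform τ) := measurable_cosTransform τ
  set M := ∫⁻ u in Ioi (0 : ℝ), ENNReal.ofReal (u ^ (l - 1))
    * ENNReal.ofReal |cosTransform τ u| ^ (2 : ℝ) with hMdef
  have hM : ENNReal.ofReal (Gamma l) ≤ M := by
    have hG : ENNReal.ofReal (Gamma (2 - l)) ≠ 0 := by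
      simpa using Gamma_pos_of_pos (by linarith : 0 < 2 - l)
    rw [← ENNReal.mul_le_mul_iff_right hG ENNReal.ofReal_ne_top,
      ← hμ.lintegral_sq_cosTransform (by linarith) hl', mul_comm]
    gcongr
    exact Gamma_two_sub_le hl hl'
  set w : Fin n → ℝ := fun k => a k ^ 2 / σ with hw
  have hw0 (k : Fin n) : 0 ≤ w k := by positivity
  have hw1 : ∑ k, w k = 1 := by rw [← Finset.sum_div, ha, div_self hσ.ne']
  set f : Fin n → ℝ → ℝ≥0∞ := fun k u => ENNReal.ofReal (u ^ (l - 1))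
    * ENNReal.ofReal |cosTransform τ (a k ^ 2 * u)| ^ (w k)⁻¹ with hf
  have hprod (u : ℝ) : ENNReal.ofReal (u ^ (l - 1))
      * ENNReal.ofReal |∏ k, cosTransform τ (a k ^ 2 * u)| = ∏ k, f k u ^ w k := by
    simp_rw [hf, ENNReal.mul_rpow_of_nonneg _ _ (hw0 _)]
    rw [Finset.prod_mul_distrib, ENNReal.prod_rpow_eq_rpow_sum _ _ fun k _ => hw0 k, hw1,
      ENNReal.rpow_one, Finset.abs_prod, ENNReal.ofReal_prod_of_nonneg fun k _ => abs_nonneg _]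
    congr 1
    refine Finset.prod_congr rfl fun k _ => ?_
    rw [← ENNReal.rpow_mul]
    rcases (hw0 k).eq_or_lt with h | h
    · have hk : a k ^ 2 = 0 := by simpa [hw, hσ.ne'] using h.symm
      simp [hk, cosTransform_zero]
    · rw [inv_mul_cancel₀ h.ne', ENNReal.rpow_one]
  have hfk (k : Fin n) :
      (∫⁻ u in Ioi (0 : ℝ), f k u) ^ w k ≤ (ENNReal.ofReal ((2 / σ) ^ l) * M) ^ w k := by
    rcases (hw0 k).eq_or_lt with h | h
    · simp [← h]
    have hk : 0 < a k ^ 2 := by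
      have := mul_pos h hσ
      rwa [hw, div_mul_cancel₀ _ hσ.ne'] at this
    refine ENNReal.rpow_le_rpow ?_ (hw0 k)
    rw [hf, lintegral_rpow_mul_comp_mul hk
      (ψ := fun u => ENNReal.ofReal |cosTransform τ u| ^ (w k)⁻¹) (by fun_prop)]
    have hs : 2 ≤ (w k)⁻¹ := by
      rw [le_inv_comm₀ two_pos h, hw, div_le_iff₀ hσ]
      linarith [hle k]
    have hmain := lintegral_rpow_mul_rpow_le hl (by linarith) hs
      (b := fun u => |cosTransform τ u|) (by fun_prop) (fun u => abs_nonneg _)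
      (fun u hu hu' => hτs.abs_integral_cos_le_cube hu hu')
      (fun u hu => hτs.abs_integral_cos_le_of_le hu) hM
    refine (mul_le_mul_right hmain _).trans_eq ?_
    rw [← mul_assoc, ENNReal.ofReal_rpow_of_pos hk, ← ENNReal.ofReal_mul (by positivity),
      rpow_neg hk.le, ← inv_rpow hk.le, ← mul_rpow (by positivity) (by positivity)]
    congr 3
    have hk' : a k ≠ 0 := fun h => by simp [h] at hk
    simp only [hw]
    field_simp
  calc ∫⁻ u in Ioi (0 : ℝ), ENNReal.ofReal (u ^ (l - 1))
        * ENNReal.ofReal |∏ k, cosTransform τ (a k ^ 2 * u)|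
      = ∫⁻ u in Ioi (0 : ℝ), ∏ k, f k u ^ w k := lintegral_congr hprod
    _ ≤ ∏ k, (∫⁻ u in Ioi (0 : ℝ), f k u) ^ w k :=
        ENNReal.lintegral_prod_norm_pow_le Finset.univ (fun k _ => by fun_prop) hw1
          fun k _ => hw0 k
    _ ≤ ∏ k, (ENNReal.ofReal ((2 / σ) ^ l) * M) ^ w k := Finset.prod_le_prod' fun k _ => hfk k
    _ = ENNReal.ofReal ((2 / σ) ^ l) * M := by
        rw [ENNReal.prod_rpow_eq_rpow_sum _ _ fun k _ => hw0 k, hw1, ENNReal.rpow_one]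

lemma IsUniformOnSphere.lintegral_sq_norm_sum_rpow_le {μ : Measure (EuclideanSpace ℝ (Fin 4))}
    [IsProbabilityMeasure μ] (hμ : IsUniformOnSphere μ) {l : ℝ} (hl : 1 ≤ l) (hl' : l < 3 / 2)
    {n : ℕ} {a : Fin n → ℝ} (ha : a ≠ 0) :
    ∫⁻ x, ENNReal.ofReal (‖∑ k, a k • x k‖ ^ 2) ^ (-l) ∂(Measure.pi fun _ : Fin n => μ)
      ≤ ENNReal.ofReal ((2 / ∑ k, a k ^ 2) ^ l)
        * ENNReal.ofReal (Gamma (3 - 2 * l) / (Gamma (2 - l) * Gamma (3 - l))) := by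
  obtain ⟨i, hi⟩ := Function.ne_iff.1 ha
  have hσ : 0 < ∑ k, a k ^ 2 :=
    Finset.sum_pos' (fun k _ => sq_nonneg _) ⟨i, Finset.mem_univ i, sq_pos_of_ne_zero hi⟩
  by_cases hle : ∀ k, a k ^ 2 ≤ (∑ k, a k ^ 2) / 2
  · have : IsProbabilityMeasure ((Measure.pi fun _ : Fin n => μ).map fun x => ∑ k, a k • x k) :=
      Measure.isProbabilityMeasure_map (Measurable.aemeasurable (by fun_prop))
    have hB := measurable_cosTransform (μ.map fun x => x 0)
    have h := lintegral_sq_norm_rpow_le (hμ.charFun_map_sum_smul a)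
      (G := fun u => ∏ k, cosTransform (μ.map fun x => x 0) (a k ^ 2 * u)) (by fun_prop)
      (by linarith : 0 < l) (by linarith)
    rw [lintegral_map (by fun_prop) (by fun_prop)] at h
    have hG : ENNReal.ofReal (Gamma l) ≠ 0 := by
      simpa using Gamma_pos_of_pos (by linarith : 0 < l)
    rw [← ENNReal.mul_le_mul_iff_right hG ENNReal.ofReal_ne_top]
    refine h.trans ?_
    rw [mul_left_comm, hμ.lintegral_sq_cosTransform (by linarith) hl', mul_left_comm]
    gcongr
    exact hμ.lintegral_prod_cosTransform_le hl hl' a hσ rfl hle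
  · push Not at hle
    obtain ⟨k, hk⟩ := hle
    have hk0 : 0 < a k ^ 2 := (half_pos hσ).trans hk
    obtain _ | n := n
    · exact k.elim0
    refine (hμ.lintegral_sq_norm_sum_rpow_le_of_coeff hl hl' a (k := k)
      (fun h => by simp [h] at hk0)).trans ?_
    gcongr
    rw [ENNReal.ofReal_rpow_of_pos hk0, rpow_neg hk0.le, ← inv_rpow hk0.le]
    gcongr
    rw [inv_le_comm₀ hk0 (by positivity), inv_div]
    exact hk.le

lemma nnnorm_rpow_neg_eq {E : Type*} [SeminormedAddCommGroup E] (x : E) (p : ℝ) :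
    (‖x‖₊ : ℝ≥0∞) ^ (-p) = ENNReal.ofReal (‖x‖ ^ 2) ^ (-(p / 2)) := by
  rw [ENNReal.ofReal_pow (norm_nonneg x), ofReal_norm, ← ENNReal.rpow_natCast,
    ← ENNReal.rpow_mul]
  congr 1
  push_cast
  ring

/-- For `2 < p < 3`, sums `S = ∑ aₖ ξₖ` of independent random vectors uniform on
the unit sphere `S³` in `ℝ⁴` satisfy
`E|S|^{-p} ≤ 2^{p/2} (Γ(3-p)/(Γ(2-p/2)Γ(3-p/2))) (∑ aₖ²)^{-p/2}`,
with equality when `n = 2` and `a₁ = a₂`. -/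
theorem neg_moment_bound_dim_four_two_point_constant
    (p : ℝ) (hp2 : 2 < p) (hp3 : p < 3)
    (μ : Measure (EuclideanSpace ℝ (Fin 4))) [IsProbabilityMeasure μ]
    (hμ : IsUniformOnSphere μ) :
    (∀ (n : ℕ), 1 ≤ n → ∀ a : Fin n → ℝ, a ≠ 0 →
      ∫⁻ x, (‖∑ k, a k • x k‖₊ : ℝ≥0∞) ^ (-p) ∂(Measure.pi fun _ : Fin n => μ)
        ≤ ENNReal.ofReal ((2 : ℝ) ^ (p / 2) *
            (Real.Gamma (3 - p) / (Real.Gamma (2 - p / 2) * Real.Gamma (3 - p / 2))) *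
            (∑ k, (a k) ^ 2) ^ (-p / 2)))
    ∧ (∀ c : ℝ, c ≠ 0 →
      ∫⁻ x, (‖∑ k, c • x k‖₊ : ℝ≥0∞) ^ (-p) ∂(Measure.pi fun _ : Fin 2 => μ)
        = ENNReal.ofReal ((2 : ℝ) ^ (p / 2) *
            (Real.Gamma (3 - p) / (Real.Gamma (2 - p / 2) * Real.Gamma (3 - p / 2))) *
            (∑ _k : Fin 2, c ^ 2) ^ (-p / 2))) := by
  have hconst (σ : ℝ) (hσ : 0 ≤ σ) : ENNReal.ofReal ((2 : ℝ) ^ (p / 2) *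
      (Gamma (3 - p) / (Gamma (2 - p / 2) * Gamma (3 - p / 2))) * σ ^ (-p / 2))
      = ENNReal.ofReal ((2 / σ) ^ (p / 2)) * ENNReal.ofReal (Gamma (3 - 2 * (p / 2))
        / (Gamma (2 - p / 2) * Gamma (3 - p / 2))) := by
    rw [← ENNReal.ofReal_mul (by positivity), div_rpow zero_le_two hσ, neg_div, rpow_neg hσ,
      mul_div_cancel₀ p two_ne_zero]
    congr 1
    ring
  simp_rw [nnnorm_rpow_neg_eq]
  refine ⟨fun n _ a ha => ?_, fun c hc => ?_⟩
  · rw [hconst _ (Finset.sum_nonneg fun k _ => sq_nonneg _)]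
    exact hμ.lintegral_sq_norm_sum_rpow_le (by linarith) (by linarith) ha
  · have hc2 : 0 < c ^ 2 := by positivity
    rw [hconst _ (Finset.sum_nonneg fun k _ => sq_nonneg _),
      hμ.lintegral_sq_norm_sum_two_rpow (by linarith) hc, ENNReal.ofReal_rpow_of_pos hc2,
      Fin.sum_univ_two, ← two_mul, div_mul_cancel_left₀ two_ne_zero, inv_rpow hc2.le,
      ← rpow_neg hc2.le]
end

section
/- Let d ≥ 1, let ξ be a random vector uniform on the unit Euclidean sphere S^{d-1} in ℝ^d, and let p < d - 1. Then for every 0 < t < 1, E|e_1 + √t ξ|^{-p} = Σ_{k=0}^∞ [ (p/2)_k · ((p-d+2)/2)_k / ( (d/2)_k · k! ) ] t^k, i.e. this expectation equals the Gauss hypergeometric function ₂F₁(p/2, (p-d+2)/2; d/2; t). -/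
open MeasureTheory Real Set
open scoped ENNReal

/-- The rising factorial (Pochhammer symbol) `(x)_k = x(x+1)⋯(x+k-1)`. -/
noncomputable def risingFac (x : ℝ) (k : ℕ) : ℝ := ∏ i ∈ Finset.range k, (x + i)

theorem risingFac_eq_ascPochhammer (x : ℝ) (k : ℕ) :
    risingFac x k = (ascPochhammer ℝ k).eval x := by
  induction k with
  | zero => simp [risingFac]
  | succ k ih => rw [ascPochhammer_succ_eval, ← ih, risingFac, risingFac, Finset.prod_range_succ]

theorem risingFac_zero (x : ℝ) : risingFac x 0 = 1 := by simp [risingFac]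

theorem risingFac_succ (x : ℝ) (k : ℕ) : risingFac x (k + 1) = risingFac x k * (x + k) := by
  rw [risingFac, risingFac, Finset.prod_range_succ]

theorem risingFac_add (x : ℝ) (m n : ℕ) :
    risingFac x (m + n) = risingFac x m * risingFac (x + m) n := by
  rw [risingFac, Finset.prod_range_add, risingFac, risingFac]
  congr 1
  refine Finset.prod_congr rfl fun i _ => ?_
  push_cast
  ring

theorem risingFac_pos {x : ℝ} (hx : 0 < x) (k : ℕ) : 0 < risingFac x k :=
  Finset.prod_pos fun _ _ => by positivity

theorem risingFac_nonneg {x : ℝ} (hx : 0 ≤ x) (k : ℕ) : 0 ≤ risingFac x k :=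
  Finset.prod_nonneg fun _ _ => by positivity

theorem abs_risingFac_le (x : ℝ) (k : ℕ) : |risingFac x k| ≤ risingFac |x| k := by
  rw [risingFac, Finset.abs_prod]
  refine Finset.prod_le_prod (fun _ _ => abs_nonneg _) fun i _ => ?_
  exact (abs_add_le _ _).trans (by simp)

theorem neg_one_pow_mul_risingFac (x : ℝ) (k : ℕ) :
    (-1) ^ k * risingFac x k = risingFac (1 - x - k) k := by
  rw [risingFac, risingFac, ← Finset.prod_range_reflect (fun i : ℕ => 1 - x - (k : ℝ) + i)]
  conv_lhs => rw [← Finset.card_range k, ← Finset.prod_const, Finset.card_range]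
  rw [← Finset.prod_mul_distrib]
  refine Finset.prod_congr rfl fun i hi => ?_
  have hi : i + 1 ≤ k := Finset.mem_range.mp hi
  rw [Nat.sub_sub, add_comm 1 i, Nat.cast_sub hi]
  push_cast
  ring

theorem risingFac_two_mul (x : ℝ) (m : ℕ) :
    risingFac x (2 * m) = 4 ^ m * (risingFac (x / 2) m * risingFac ((x + 1) / 2) m) := by
  induction m with
  | zero => simp [risingFac_zero]
  | succ m ih =>
    rw [show 2 * (m + 1) = 2 * m + 1 + 1 by ring]
    simp only [risingFac_succ, ih]
    push_cast
    ring

theorem factorial_two_mul_eq (m : ℕ) :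
    ((2 * m).factorial : ℝ) = 4 ^ m * (risingFac (1 / 2) m * m.factorial) := by
  induction m with
  | zero => simp [risingFac_zero]
  | succ m ih =>
    rw [show 2 * (m + 1) = 2 * m + 1 + 1 by ring]
    simp only [risingFac_succ, Nat.factorial_succ]
    push_cast
    rw [ih]
    ring

theorem choose_neg_eq_risingFac (a : ℝ) (n : ℕ) :
    Ring.choose (-a) n = (-1) ^ n * (risingFac a n / n.factorial) := by
  have h : (n.factorial : ℝ) * Ring.multichoose a n = risingFac a n := by
    rw [← nsmul_eq_mul, Ring.factorial_nsmul_multichoose_eq_ascPochhammer,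
      Polynomial.ascPochhammer_smeval_eq_eval, risingFac_eq_ascPochhammer]
  rw [Ring.choose_neg', ← h, mul_div_cancel_left₀ _ (by positivity)]
  simp [Units.smul_def, Int.negOnePow_def]

theorem sum_antidiagonal_risingFac (a b : ℝ) (n : ℕ) :
    ∑ ij ∈ Finset.HasAntidiagonal.antidiagonal n,
      risingFac a ij.1 / ij.1.factorial * (risingFac b ij.2 / ij.2.factorial) =
        risingFac (a + b) n / n.factorial := by
  have h := Ring.add_choose_eq n (Commute.all (-a) (-b))
  rw [← neg_add, choose_neg_eq_risingFac] at h
  have h1 : ((-1 : ℝ) ^ n) * (-1) ^ n = 1 := by rw [← mul_pow]; simp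
  calc _ = (-1) ^ n * ∑ ij ∈ Finset.HasAntidiagonal.antidiagonal n,
        Ring.choose (-a) ij.1 * Ring.choose (-b) ij.2 := by
        rw [Finset.mul_sum]
        refine Finset.sum_congr rfl fun ij hij => ?_
        rw [choose_neg_eq_risingFac, choose_neg_eq_risingFac]
        rw [← Finset.HasAntidiagonal.mem_antidiagonal.mp hij] at h1 ⊢
        rw [pow_add] at h1 ⊢
        linear_combination (-(risingFac a ij.1 / ij.1.factorial *
          (risingFac b ij.2 / ij.2.factorial))) * h1
    _ = _ := by rw [← h, ← mul_assoc, h1, one_mul]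

/-- The Taylor coefficients of `(1 + t) ^ (-a) * ₂F₁(a/2, (a+1)/2; b; 4t/(1+t)²)`. -/
theorem sum_antidiagonal_quadratic (a : ℝ) {b : ℝ} (hb : 0 < b) (n : ℕ) :
    ∑ ij ∈ Finset.HasAntidiagonal.antidiagonal n,
      risingFac a (2 * ij.1) / (risingFac b ij.1 * ij.1.factorial) *
        ((-1) ^ ij.2 * (risingFac (a + 2 * ij.1) ij.2 / ij.2.factorial)) =
      risingFac a n * risingFac (a - b + 1) n / (risingFac b n * n.factorial) := by
  have key : ∀ ij ∈ Finset.HasAntidiagonal.antidiagonal n,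
      risingFac a (2 * ij.1) / (risingFac b ij.1 * ij.1.factorial) *
        ((-1) ^ ij.2 * (risingFac (a + 2 * ij.1) ij.2 / ij.2.factorial)) =
      risingFac a n / risingFac b n * (risingFac (a + n) ij.1 / ij.1.factorial *
        (risingFac (1 - b - n) ij.2 / ij.2.factorial)) := by
    rintro ⟨i, j⟩ hij
    obtain rfl : i + j = n := Finset.HasAntidiagonal.mem_antidiagonal.mp hij
    have h1 := risingFac_add a (2 * i) j
    rw [show 2 * i + j = i + j + i by ring, risingFac_add a (i + j) i] at h1
    have h2 := neg_one_pow_mul_risingFac (b + i) j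
    rw [show 1 - (b + i) - (j : ℝ) = 1 - b - (i + j : ℕ) by push_cast; ring] at h2
    have hbi := (risingFac_pos hb i).ne'
    have hbj := (risingFac_pos (by positivity : 0 < b + i) j).ne'
    dsimp only
    rw [← h2, risingFac_add b i j]
    push_cast at h1 ⊢
    field_simp
    linear_combination -h1
  rw [Finset.sum_congr rfl key, ← Finset.mul_sum, sum_antidiagonal_risingFac,
    show a + n + (1 - b - n) = a - b + 1 by ring]
  field_simp

theorem hasSum_risingFac_mul_pow (a : ℝ) {y : ℝ} (hy : |y| < 1) :
    HasSum (fun n : ℕ => risingFac a n / n.factorial * y ^ n) ((1 - y) ^ (-a)) := by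
  have h := (Real.one_add_rpow_hasFPowerSeriesOnBall_zero (a := -a)).hasSum (y := -y)
    (by simpa [enorm_eq_nnnorm, ← NNReal.coe_lt_one] using hy)
  rw [zero_add, ← sub_eq_add_neg] at h
  refine h.congr_fun ?_
  intro n
  have h1 : ((-1 : ℝ) ^ n) * (-1) ^ n = 1 := by rw [← mul_pow]; simp
  simp only [binomialSeries_apply, choose_neg_eq_risingFac, List.ofFn_const, List.prod_replicate,
    smul_eq_mul, neg_pow y]
  linear_combination (-(risingFac a n / n.factorial * y ^ n)) * h1

theorem one_le_radius_ordinaryHypergeometricSeries (a b c : ℝ) :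
    1 ≤ (ordinaryHypergeometricSeries ℝ a b c).radius := by
  by_cases h : ∀ k : ℕ, (k : ℝ) ≠ -a ∧ (k : ℝ) ≠ -b ∧ (k : ℝ) ≠ -c
  · exact (ordinaryHypergeometricSeries_radius_eq_one ℝ a b c h).ge
  · push Not at h
    obtain ⟨k, hk⟩ := h
    by_cases ha : (k : ℝ) = -a
    · obtain rfl : a = -(k : ℝ) := by linarith
      simp [ordinaryHypergeometric_radius_top_of_neg_nat₁ (𝕂 := ℝ) ℝ b c]
    by_cases hb : (k : ℝ) = -b
    · obtain rfl : b = -(k : ℝ) := by linarith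
      simp [ordinaryHypergeometric_radius_top_of_neg_nat₂ (𝕂 := ℝ) ℝ a c]
    obtain rfl : c = -(k : ℝ) := by linarith [hk ha hb]
    simp [ordinaryHypergeometric_radius_top_of_neg_nat₃ (𝕂 := ℝ) ℝ a b]

theorem ordinaryHypergeometricSeries_eq_risingFac (a b c x : ℝ) (n : ℕ) :
    (ordinaryHypergeometricSeries ℝ a b c n fun _ => x) =
      risingFac a n * risingFac b n / (risingFac c n * n.factorial) * x ^ n := by
  rw [ordinaryHypergeometricSeries_apply_eq]
  simp only [← risingFac_eq_ascPochhammer, smul_eq_mul]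
  field_simp

theorem hasSum_ordinaryHypergeometric (a b c : ℝ) {x : ℝ} (hx : |x| < 1) :
    HasSum (fun n : ℕ => risingFac a n * risingFac b n / (risingFac c n * n.factorial) * x ^ n)
      (₂F₁ a b c x) := by
  simp_rw [← ordinaryHypergeometricSeries_eq_risingFac]
  refine FormalMultilinearSeries.hasSum _ ?_
  refine Metric.eball_subset_eball (one_le_radius_ordinaryHypergeometricSeries a b c) ?_
  simpa [enorm_eq_nnnorm, ← NNReal.coe_lt_one] using hx

theorem analyticAt_ordinaryHypergeometric (a b c : ℝ) {x : ℝ} (hx : |x| < 1) :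
    AnalyticAt ℝ (₂F₁ a b c : ℝ → ℝ) x := by
  have hr := one_le_radius_ordinaryHypergeometricSeries a b c
  refine ((ordinaryHypergeometricSeries ℝ a b c).hasFPowerSeriesOnBall
    (zero_lt_one.trans_le hr)).analyticAt_of_mem ?_
  refine Metric.eball_subset_eball hr ?_
  simpa [enorm_eq_nnnorm, ← NNReal.coe_lt_one] using hx

theorem one_add_rpow_mul_pow {t : ℝ} (ht : 0 < 1 + t) (a : ℝ) (b : ℝ) (i : ℕ) :
    risingFac a (2 * i) / (risingFac b i * i.factorial) * t ^ i * (1 + t) ^ (-(a + 2 * i)) =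
      (1 + t) ^ (-a) * (risingFac (a / 2) i * risingFac ((a + 1) / 2) i /
        (risingFac b i * i.factorial) * (4 * t / (1 + t) ^ 2) ^ i) := by
  rw [neg_add, Real.rpow_add ht, Real.rpow_neg ht.le (2 * (i : ℝ)), risingFac_two_mul,
    show (2 * (i : ℝ)) = ((2 * i : ℕ) : ℝ) by push_cast; rfl, Real.rpow_natCast, pow_mul, div_pow,
    mul_pow]
  field_simp

/-- Quadratic transformation of `₂F₁`, near the origin. -/
theorem ordinaryHypergeometric_quadratic_of_small (a : ℝ) {b : ℝ} (hb : 0 < b) {t : ℝ}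
    (ht0 : 0 < t) (ht1 : t < 1 / 10) :
    (1 + t) ^ (-a) * ₂F₁ (a / 2) ((a + 1) / 2) b (4 * t / (1 + t) ^ 2) =
      ₂F₁ a (a - b + 1) b t := by
  have ht : |t| < 1 := by rw [abs_of_pos ht0]; linarith
  have hs : |4 * t / (1 + t) ^ 2| < 1 := by
    rw [abs_of_pos (by positivity), div_lt_one (by positivity)]; nlinarith
  have hs' : |4 * -t / (1 + -t) ^ 2| < 1 := by
    have : 0 < (1 + -t) ^ 2 := by nlinarith
    rw [mul_neg, neg_div, abs_neg, abs_of_pos (by positivity), div_lt_one (by positivity)]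
    nlinarith
  let f : ℕ × ℕ → ℝ := fun ij =>
    risingFac a (2 * ij.1) / (risingFac b ij.1 * ij.1.factorial) * t ^ ij.1 *
      (risingFac (a + 2 * ij.1) ij.2 / ij.2.factorial * (-t) ^ ij.2)
  let g : ℕ × ℕ → ℝ := fun ij =>
    risingFac |a| (2 * ij.1) / (risingFac b ij.1 * ij.1.factorial) * t ^ ij.1 *
      (risingFac (|a| + 2 * ij.1) ij.2 / ij.2.factorial * t ^ ij.2)
  have hrow : ∀ i, HasSum (fun j => f (i, j))
      (risingFac a (2 * i) / (risingFac b i * i.factorial) * t ^ i *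
        (1 + t) ^ (-(a + 2 * i))) := fun i => by
    have h := hasSum_risingFac_mul_pow (a + 2 * i) (y := -t) (by simpa using ht)
    rw [sub_neg_eq_add] at h
    exact h.mul_left _
  have hrow' : ∀ i, HasSum (fun j => g (i, j))
      (risingFac |a| (2 * i) / (risingFac b i * i.factorial) * t ^ i *
        (1 + -t) ^ (-(|a| + 2 * i))) := fun i => by
    have h := hasSum_risingFac_mul_pow (|a| + 2 * i) ht
    rw [sub_eq_add_neg] at h
    exact h.mul_left _
  have hg0 : 0 ≤ g := fun ij => by
    have h1 := risingFac_nonneg (abs_nonneg a) (2 * ij.1)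
    have h2 := risingFac_nonneg (by positivity : 0 ≤ |a| + 2 * ij.1) ij.2
    have h3 := risingFac_pos hb ij.1
    simp only [Pi.zero_apply, g]
    positivity
  have hg : Summable g := by
    rw [summable_prod_of_nonneg hg0]
    refine ⟨fun i => (hrow' i).summable, ?_⟩
    simp_rw [fun i => (hrow' i).tsum_eq]
    have h := ((hasSum_ordinaryHypergeometric (|a| / 2) ((|a| + 1) / 2) b hs').summable.mul_left
      ((1 + -t) ^ (-|a|))).norm
    refine h.of_norm_bounded_eventually_nat ?_
    filter_upwards with i
    rw [← one_add_rpow_mul_pow (by linarith), norm_mul, norm_mul, norm_mul, norm_mul, norm_pow,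
      norm_pow, norm_neg]
  have hf : Summable f := by
    refine hg.of_norm_bounded fun ij => ?_
    have h3 := risingFac_pos hb ij.1
    simp only [f, g, norm_mul, norm_div, norm_pow, norm_neg, Real.norm_eq_abs, abs_of_pos ht0,
      abs_of_pos h3, Nat.abs_cast]
    have h4 : |risingFac (a + 2 * ij.1) ij.2| ≤ risingFac (|a| + 2 * ij.1) ij.2 := by
      refine (Finset.abs_prod _ _).le.trans ?_
      refine Finset.prod_le_prod (fun _ _ => abs_nonneg _) fun i _ => ?_
      rw [add_assoc, add_assoc]
      refine (abs_add_le _ _).trans ?_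
      rw [abs_of_nonneg (by positivity : (0 : ℝ) ≤ 2 * ij.1 + i)]
    have h5 := abs_risingFac_le a (2 * ij.1)
    have h6 := risingFac_nonneg (abs_nonneg a) (2 * ij.1)
    have h7 : 0 ≤ risingFac |a| (2 * ij.1) / (risingFac b ij.1 * ij.1.factorial) * t ^ ij.1 := by
      positivity
    gcongr
  have hsum1 : HasSum f ((1 + t) ^ (-a) * ₂F₁ (a / 2) ((a + 1) / 2) b (4 * t / (1 + t) ^ 2)) := by
    have h := (hasSum_ordinaryHypergeometric (a / 2) ((a + 1) / 2) b hs).mul_left ((1 + t) ^ (-a))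
    simp_rw [← one_add_rpow_mul_pow (by linarith : 0 < 1 + t)] at h
    have h' := hf.hasSum.prod_fiberwise hrow
    rw [h.unique h']
    exact hf.hasSum
  have hsum2 := (Finset.HasAntidiagonal.sigmaAntidiagonalEquivProd.hasSum_iff.mpr hsum1).sigma
    fun n => hasSum_fintype _
  refine hsum2.unique ((hasSum_ordinaryHypergeometric a (a - b + 1) b ht).congr_fun fun n => ?_)
  rw [← sum_antidiagonal_quadratic a hb n, Finset.sum_mul,
    ← Finset.sum_coe_sort (Finset.HasAntidiagonal.antidiagonal n)]
  refine Finset.sum_congr rfl fun ij _ => ?_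
  have := Finset.HasAntidiagonal.mem_antidiagonal.mp ij.2
  simp only [f, Function.comp, Finset.HasAntidiagonal.sigmaAntidiagonalEquivProd_apply]
  have ht' : t ^ n = t ^ ij.1.1 * t ^ ij.1.2 := by rw [← pow_add, this]
  rw [ht', neg_pow t]
  ring

/-- Quadratic transformation of `₂F₁`. -/
theorem ordinaryHypergeometric_quadratic (a : ℝ) {b : ℝ} (hb : 0 < b) {t : ℝ}
    (ht0 : 0 < t) (ht1 : t < 1) :
    (1 + t) ^ (-a) * ₂F₁ (a / 2) ((a + 1) / 2) b (4 * t / (1 + t) ^ 2) =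
      ₂F₁ a (a - b + 1) b t := by
  have h1 : AnalyticOnNhd ℝ (fun t : ℝ => (1 + t) ^ (-a) *
      ₂F₁ (a / 2) ((a + 1) / 2) b (4 * t / (1 + t) ^ 2)) (Ioo 0 1) := by
    intro s hs
    have hs0 : 0 < 1 + s := by linarith [hs.1]
    have h4 : |4 * s / (1 + s) ^ 2| < 1 := by
      have := hs.1
      rw [abs_of_pos (by positivity), div_lt_one (by positivity)]
      nlinarith [hs.2]
    have hquot : AnalyticAt ℝ (fun s : ℝ => 4 * s / (1 + s) ^ 2) s :=
      (analyticAt_const.mul analyticAt_id).div ((analyticAt_const.add analyticAt_id).pow 2)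
        (by simpa using hs0.ne')
    refine AnalyticAt.mul ?_ (AnalyticAt.fun_comp
      (f := fun s : ℝ => 4 * s / (1 + s) ^ 2) (analyticAt_ordinaryHypergeometric _ _ _ h4) hquot)
    refine ContDiffAt.analyticAt ?_
    exact (contDiffAt_const.add contDiffAt_id).rpow contDiffAt_const hs0.ne'
  have h2 : AnalyticOnNhd ℝ (₂F₁ a (a - b + 1) b : ℝ → ℝ) (Ioo 0 1) := fun s hs =>
    analyticAt_ordinaryHypergeometric _ _ _ (by rw [abs_of_pos hs.1]; exact hs.2)
  refine h1.eqOn_of_preconnected_of_eventuallyEq h2 isPreconnected_Ioo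
    (z₀ := 1 / 20) (by constructor <;> norm_num) ?_ ⟨ht0, ht1⟩
  filter_upwards [Ioo_mem_nhds (by norm_num : (0 : ℝ) < 1 / 20)
    (by norm_num : (1 / 20 : ℝ) < 1 / 10)] with s hs
  exact ordinaryHypergeometric_quadratic_of_small a hb hs.1 hs.2

section Sphere

variable {d : ℕ} {μ : Measure (EuclideanSpace ℝ (Fin d))}

theorem IsUniformOnSphere.ae_norm_eq_one_s5 (hμ : IsUniformOnSphere μ) : ∀ᵐ x ∂μ, ‖x‖ = 1 := by
  have h : ∀ᵐ x ∂μ, x ∈ Metric.sphere (0 : EuclideanSpace ℝ (Fin d)) 1 := hμ.1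
  filter_upwards [h] with x hx
  simpa using hx

theorem IsUniformOnSphere.integrable_of_continuous [IsFiniteMeasure μ] (hμ : IsUniformOnSphere μ)
    {f : EuclideanSpace ℝ (Fin d) → ℝ} (hf : Continuous f) : Integrable f μ := by
  obtain ⟨C, hC⟩ := (isCompact_sphere (0 : EuclideanSpace ℝ (Fin d)) 1).exists_bound_of_continuousOn
    hf.continuousOn
  refine Integrable.of_bound hf.aestronglyMeasurable C ?_
  filter_upwards [hμ.ae_norm_eq_one_s5] with x hx
  exact hC x (by simpa using hx)

theorem IsUniformOnSphere.integral_inner_pow (hμ : IsUniformOnSphere μ)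
    {v w : EuclideanSpace ℝ (Fin d)} (h : ‖v‖ = ‖w‖) (n : ℕ) :
    ∫ x, inner ℝ v x ^ n ∂μ = ∫ x, inner ℝ w x ^ n ∂μ := by
  let Q := (ℝ ∙ (v - w))ᗮ.reflection
  have hQ : Q v = w := Submodule.reflection_sub h
  conv_rhs => rw [← hμ.2 Q, integral_map Q.continuous.aemeasurable
    (Continuous.aestronglyMeasurable (by fun_prop)), ← hQ]
  simp only [LinearIsometryEquiv.inner_map_map]

theorem IsUniformOnSphere.integral_coord_pow_odd (hμ : IsUniformOnSphere μ) (z : Fin d) (m : ℕ) :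
    ∫ x, x z ^ (2 * m + 1) ∂μ = 0 := by
  have h := hμ.integral_inner_pow (v := EuclideanSpace.single z 1)
    (w := -EuclideanSpace.single z 1) (by simp) (2 * m + 1)
  simp only [inner_neg_left, EuclideanSpace.inner_single_left, map_one, one_mul,
    Odd.neg_pow ⟨m, rfl⟩, integral_neg] at h
  linarith

theorem IsUniformOnSphere.integral_coord_pow_mul_sq [IsFiniteMeasure μ] (hμ : IsUniformOnSphere μ)
    {z i : Fin d} (hi : i ≠ z) (m : ℕ) :
    (2 * m + 1) * ∫ x, x z ^ (2 * m) * x i ^ 2 ∂μ = ∫ x, x z ^ (2 * (m + 1)) ∂μ := by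
  open Polynomial in
  let b : ℕ → ℝ := fun j => ∫ x, x i ^ j * x z ^ (2 * (m + 1) - j) ∂μ
  let P : ℝ[X] := ∑ j ∈ Finset.range (2 * (m + 1) + 1),
    C (b j * (2 * (m + 1)).choose j) * X ^ j
  let R : ℝ[X] := C (∫ x, x z ^ (2 * (m + 1)) ∂μ) * expand ℝ 2 ((1 + X) ^ (m + 1))
  have hPR : P = R := by
    refine Polynomial.funext fun s => ?_
    have hs : 0 ≤ 1 + s ^ 2 := by positivity
    have hnorm : ‖EuclideanSpace.single i s + EuclideanSpace.single z (1 : ℝ)‖ =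
        ‖EuclideanSpace.single z (√(1 + s ^ 2))‖ := by
      rw [← sq_eq_sq₀ (norm_nonneg _) (norm_nonneg _), norm_add_sq_real]
      simp only [PiLp.norm_single, Real.norm_eq_abs, sq_abs, Real.sq_sqrt hs]
      simp [EuclideanSpace.inner_single_left, hi, add_comm]
    have h := hμ.integral_inner_pow hnorm (2 * (m + 1))
    simp only [inner_add_left, EuclideanSpace.inner_single_left, conj_trivial, one_mul, mul_pow,
      integral_const_mul, add_pow] at h
    rw [pow_mul (√(1 + s ^ 2)), Real.sq_sqrt hs, integral_finsetSum] at h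
    · simp only [P, R, eval_finsetSum, eval_mul, eval_C, eval_pow, eval_X, expand_eval, eval_add,
        eval_one]
      refine Eq.trans ?_ (h.trans (mul_comm _ _))
      refine Finset.sum_congr rfl fun j _ => ?_
      simp only [b]
      rw [← integral_mul_const, ← integral_mul_const]
      congr 1 with x
      ring
    · exact fun j _ => hμ.integrable_of_continuous (by fun_prop)
  have h2 := congrArg (fun p => Polynomial.coeff p 2) hPR
  have hR : R.coeff 2 = (∫ x, x z ^ (2 * (m + 1)) ∂μ) * (m + 1) := by
    have := coeff_expand_mul (R := ℝ) (p := 2) (by norm_num) ((1 + X) ^ (m + 1)) 1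
    simp only [R, coeff_C_mul]
    rw [one_mul] at this
    rw [this, coeff_one_add_X_pow]
    simp
  have hP : P.coeff 2 = b 2 * ((m + 1) * (2 * m + 1)) := by
    simp only [P, finsetSum_coeff, coeff_C_mul_X_pow]
    rw [Finset.sum_ite_eq, if_pos (by simp), Nat.cast_choose_two]
    push_cast
    ring
  simp only [hP, hR] at h2
  have hb : b 2 = ∫ x, x z ^ (2 * m) * x i ^ 2 ∂μ := by
    simp only [b, show 2 * (m + 1) - 2 = 2 * m by omega]
    exact integral_congr_ae (.of_forall fun x => mul_comm _ _)
  rw [← hb]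
  have hm : (0 : ℝ) < m + 1 := by positivity
  refine mul_left_cancel₀ hm.ne' ?_
  linear_combination h2

theorem IsUniformOnSphere.integral_coord_pow_succ [IsFiniteMeasure μ] (hμ : IsUniformOnSphere μ)
    (z : Fin d) (m : ℕ) :
    (d / 2 + m) * ∫ x, x z ^ (2 * (m + 1)) ∂μ = (1 / 2 + m) * ∫ x, x z ^ (2 * m) ∂μ := by
  have h1 : ∫ x, x z ^ (2 * m) ∂μ = ∑ i, ∫ x, x z ^ (2 * m) * x i ^ 2 ∂μ := by
    rw [← integral_finsetSum _ fun i _ => hμ.integrable_of_continuous (by fun_prop)]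
    refine integral_congr_ae ?_
    filter_upwards [hμ.ae_norm_eq_one_s5] with x hx
    rw [← Finset.mul_sum, ← EuclideanSpace.real_norm_sq_eq, hx]
    simp
  have h2 : ∀ i ∈ Finset.univ.erase z, (2 * m + 1) * ∫ x, x z ^ (2 * m) * x i ^ 2 ∂μ =
      ∫ x, x z ^ (2 * (m + 1)) ∂μ :=
    fun i hi => hμ.integral_coord_pow_mul_sq (Finset.ne_of_mem_erase hi) m
  have hd : 1 ≤ d := z.pos
  rw [← Finset.add_sum_erase _ _ (Finset.mem_univ z)] at h1
  have h3 := Finset.sum_congr rfl h2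
  rw [← Finset.mul_sum, Finset.sum_const, Finset.card_erase_of_mem (Finset.mem_univ z),
    Finset.card_univ, Fintype.card_fin, nsmul_eq_mul, Nat.cast_sub hd] at h3
  simp only [← pow_add, show 2 * m + 2 = 2 * (m + 1) by ring] at h1
  push_cast at h3
  linear_combination (-(2 * m + 1) / 2 : ℝ) * h1 - h3 / 2

theorem IsUniformOnSphere.integral_coord_pow_even [IsProbabilityMeasure μ]
    (hμ : IsUniformOnSphere μ) (z : Fin d) (m : ℕ) :
    ∫ x, x z ^ (2 * m) ∂μ = risingFac (1 / 2) m / risingFac (d / 2) m := by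
  have hd : (0 : ℝ) < d / 2 := by have := z.pos; positivity
  induction m with
  | zero => simp [risingFac_zero]
  | succ m ih =>
    have h := hμ.integral_coord_pow_succ z m
    have hp := risingFac_pos hd m
    have hdm : (0 : ℝ) < d / 2 + m := by positivity
    rw [ih] at h
    rw [risingFac_succ, risingFac_succ, eq_div_iff (by positivity),
      mul_comm (risingFac (d / 2 : ℝ) m), ← mul_assoc, mul_comm _ (d / 2 + m : ℝ), h]
    field_simp

theorem IsUniformOnSphere.integral_one_sub_rpow [IsProbabilityMeasure μ]
    (hμ : IsUniformOnSphere μ) (z : Fin d) (a : ℝ) {c : ℝ} (hc : |c| < 1) :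
    ∫ x, (1 - c * x z) ^ (-a) ∂μ = ₂F₁ (a / 2) ((a + 1) / 2) (d / 2 : ℝ) (c ^ 2) := by
  have hd : (0 : ℝ) < d / 2 := by have := z.pos; positivity
  have hcoord : ∀ᵐ x ∂μ, |c * x z| ≤ |c| := by
    filter_upwards [hμ.ae_norm_eq_one_s5] with x hx
    have := PiLp.norm_apply_le x z
    rw [hx, Real.norm_eq_abs] at this
    rw [abs_mul]
    exact mul_le_of_le_one_right (abs_nonneg _) this
  let F : ℕ → EuclideanSpace ℝ (Fin d) → ℝ := fun n x =>
    risingFac a n / n.factorial * (c * x z) ^ n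
  have hint : ∀ n, Integrable (F n) μ := fun n => hμ.integrable_of_continuous (by fun_prop)
  have hsum : Summable fun n => ∫ x, ‖F n x‖ ∂μ := by
    refine (hasSum_risingFac_mul_pow a (y := |c|) (by simpa using hc)).summable.norm.of_nonneg_of_le
      (fun n => integral_nonneg fun x => norm_nonneg _) fun n => ?_
    have : ∀ᵐ x ∂μ, ‖F n x‖ ≤ ‖risingFac a n / n.factorial * |c| ^ n‖ := by
      filter_upwards [hcoord] with x hx
      simp only [F, norm_mul, norm_pow, Real.norm_eq_abs, abs_abs] at hx ⊢
      rw [← abs_mul]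
      gcongr
    simpa using integral_mono_ae (hint n).norm (integrable_const _) this
  have h := hasSum_integral_of_summable_integral_norm hint hsum
  have hF : ∫ x, ∑' n, F n x ∂μ = ∫ x, (1 - c * x z) ^ (-a) ∂μ := by
    refine integral_congr_ae ?_
    filter_upwards [hcoord] with x hx
    exact (hasSum_risingFac_mul_pow a (hx.trans_lt hc)).tsum_eq
  rw [hF] at h
  have heven : Function.Injective fun m : ℕ => 2 * m := fun _ _ h => by simpa using h
  rw [← heven.hasSum_iff] at h
  · have hc2 : |c ^ 2| < 1 := by
      rw [abs_pow]
      exact pow_lt_one₀ (abs_nonneg _) hc two_ne_zero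
    refine h.unique ((hasSum_ordinaryHypergeometric _ _ _ hc2).congr_fun fun m => ?_)
    have h1 := risingFac_pos hd m
    have h2 := risingFac_pos (by norm_num : (0 : ℝ) < 1 / 2) m
    simp only [Function.comp, F, mul_pow, integral_const_mul, hμ.integral_coord_pow_even,
      risingFac_two_mul, factorial_two_mul_eq, pow_mul c]
    field_simp
  · intro n hn
    obtain ⟨m, rfl | rfl⟩ := n.even_or_odd'
    · exact absurd ⟨m, rfl⟩ hn
    · simp only [F, mul_pow, integral_const_mul, hμ.integral_coord_pow_odd, mul_zero]

end Sphere

/-- For `ξ` uniform on `S^{d-1}` and `p < d - 1`, `0 < t < 1`,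
`E|e₁ + √t ξ|^{-p} = ₂F₁(p/2, (p-d+2)/2; d/2; t)`
(expressed by its hypergeometric power series). -/
theorem two_coeff_hypergeometric_expansion
    (d : ℕ) (hd : 1 ≤ d) (p : ℝ) (hpd : p < (d : ℝ) - 1)
    (μ : Measure (EuclideanSpace ℝ (Fin d))) [IsProbabilityMeasure μ]
    (hμ : IsUniformOnSphere μ)
    (t : ℝ) (ht0 : 0 < t) (ht1 : t < 1) :
    ∫ x, ‖EuclideanSpace.single (⟨0, by omega⟩ : Fin d) (1 : ℝ) + Real.sqrt t • x‖ ^ (-p) ∂μ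
      = ∑' k : ℕ,
          (risingFac (p / 2) k * risingFac ((p - (d : ℝ) + 2) / 2) k /
            (risingFac ((d : ℝ) / 2) k * (k.factorial : ℝ))) * t ^ k := by
  set z : Fin d := ⟨0, by omega⟩
  have hd0 : (0 : ℝ) < d / 2 := by positivity
  have hsq : √t ^ 2 = t := Real.sq_sqrt ht0.le
  have hc : |-(2 * √t / (1 + t))| < 1 := by
    have : √t < 1 := (Real.sqrt_lt' one_pos).mpr (by simpa using ht1)
    rw [abs_neg, abs_of_pos (by positivity), div_lt_one (by positivity)]
    nlinarith [mul_pos (sub_pos.mpr this) (sub_pos.mpr this)]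
  calc _ = ∫ x, (1 + t) ^ (-(p / 2)) * (1 - -(2 * √t / (1 + t)) * x z) ^ (-(p / 2)) ∂μ := by
        refine integral_congr_ae ?_
        filter_upwards [hμ.ae_norm_eq_one_s5] with x hx
        have hx1 : |x z| ≤ 1 := hx ▸ PiLp.norm_apply_le x z
        have hn : ‖EuclideanSpace.single z (1 : ℝ) + √t • x‖ ^ 2 =
            (1 + t) * (1 - -(2 * √t / (1 + t)) * x z) := by
          rw [norm_add_sq_real, norm_smul, inner_smul_right, EuclideanSpace.inner_single_left,
            mul_pow, Real.norm_eq_abs, sq_abs, hsq, hx]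
          simp
          field_simp
          ring
        have h1 : 0 ≤ 1 - -(2 * √t / (1 + t)) * x z := by
          have := abs_mul (-(2 * √t / (1 + t))) (x z)
          have h2 := mul_le_one₀ hc.le (abs_nonneg _) hx1
          linarith [le_abs_self (-(2 * √t / (1 + t)) * x z)]
        rw [← Real.mul_rpow (by positivity) h1, ← hn, ← Real.rpow_natCast,
          ← Real.rpow_mul (norm_nonneg _)]
        congr 1
        push_cast
        ring
    _ = (1 + t) ^ (-(p / 2)) * ₂F₁ (p / 2 / 2) ((p / 2 + 1) / 2) (d / 2 : ℝ)
          (4 * t / (1 + t) ^ 2) := by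
        rw [integral_const_mul, hμ.integral_one_sub_rpow z (p / 2) hc, neg_sq, div_pow, mul_pow,
          hsq]
        norm_num
    _ = ₂F₁ (p / 2) (p / 2 - d / 2 + 1) (d / 2 : ℝ) t :=
        ordinaryHypergeometric_quadratic (p / 2) hd0 ht0 ht1
    _ = _ := by
        rw [show (p - d + 2) / 2 = p / 2 - d / 2 + 1 by ring]
        exact (hasSum_ordinaryHypergeometric _ _ _ (by rwa [abs_of_pos ht0])).tsum_eq.symm
end
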